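/- arXiv:0711.3916 — 13 statements merged into one kernel-verified Lean document; each statement's English description precedes it below -/
import Mathlib

section
/- Under the forward-construction hypotheses, let V : ℝ → ℝ be any function satisfying V(φ(t)) = W(t) for all t ∈ I, and set ρ = φ̇²/2 + V∘φ and p = φ̇²/2 − V∘φ. Then (X, Y, Z, φ, V) satisfies all four Bianchi I field equations on I: (i) ẊẎ/(XY) + ẊŻ/(XZ) + ẎŻ/(YZ) = K²ρ; (ii) Ẍ/X + Ÿ/Y + ẊẎ/(XY) = −K²p; (iii) Ẍ/X + Z̈/Z + ẊŻ/(XZ) = −K²p; (iv) Ÿ/Y + Z̈/Z + ẎŻ/(YZ) = −K²p. -/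
/-- The first two logarithmic derivative identities of a scale factor
`(u ∘ σ) ^ (-1/3) * exp (k * σ)` along a solution of `σ' = u ∘ σ`. -/
theorem scaleFactor_derivs {a b k E : ℝ} {P u σ F : ℝ → ℝ}
    (hu : Differentiable ℝ u) (hu' : Differentiable ℝ (deriv u))
    (hSch : ∀ x, deriv (deriv u) x + (E - P x) * u x = 0)
    (hσ : ∀ t ∈ Set.Ioo a b, HasDerivAt σ (u (σ t)) t)
    (hupos : ∀ t ∈ Set.Ioo a b, 0 < u (σ t))
    (hF : ∀ t ∈ Set.Ioo a b, F t = (u (σ t)) ^ (-(1 : ℝ) / 3) * Real.exp (k * σ t))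
    {t : ℝ} (ht : t ∈ Set.Ioo a b) :
    deriv F t / F t = -(deriv u (σ t)) / 3 + k * u (σ t) ∧
      deriv (deriv F) t / F t =
        (E - P (σ t)) * u (σ t) ^ 2 / 3 + k * u (σ t) * deriv u (σ t) +
          (-(deriv u (σ t)) / 3 + k * u (σ t)) ^ 2 := by
  have hcomp : ∀ s ∈ Set.Ioo a b,
      HasDerivAt (fun s => u (σ s)) (deriv u (σ s) * u (σ s)) s := fun s hs =>
    (hu (σ s)).hasDerivAt.comp s (hσ s hs)
  have hderiv : ∀ s ∈ Set.Ioo a b,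
      HasDerivAt F ((-(deriv u (σ s)) / 3 + k * u (σ s)) * F s) s := by
    intro s hs
    have hpos := hupos s hs
    have h := ((hcomp s hs).rpow_const (p := -(1 : ℝ) / 3) (Or.inl hpos.ne')).mul
      ((hσ s hs).const_mul k).exp
    refine (h.congr_of_eventuallyEq ?_).congr_deriv ?_
    · filter_upwards [isOpen_Ioo.mem_nhds hs] with r hr using hF r hr
    · rw [hF s hs, Real.rpow_sub_one hpos.ne']
      field_simp
  have hderiv_deriv : HasDerivAt (deriv F)
      (((E - P (σ t)) * u (σ t) ^ 2 / 3 + k * u (σ t) * deriv u (σ t) +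
        (-(deriv u (σ t)) / 3 + k * u (σ t)) ^ 2) * F t) t := by
    have hcomp' : HasDerivAt (fun s => deriv u (σ s)) (deriv (deriv u) (σ t) * u (σ t)) t :=
      (hu' (σ t)).hasDerivAt.comp t (hσ t ht)
    have h := ((hcomp'.neg.div_const 3).add ((hcomp t ht).const_mul k)).mul (hderiv t ht)
    refine (h.congr_of_eventuallyEq ?_).congr_deriv ?_
    · filter_upwards [isOpen_Ioo.mem_nhds ht] with r hr using (hderiv r hr).deriv
    · simp only [Pi.add_apply, Pi.neg_apply]
      linear_combination (-(u (σ t)) * F t / 3) * hSch (σ t)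
  have hne : F t ≠ 0 := by
    rw [hF t ht]
    have := hupos t ht
    positivity
  rw [(hderiv t ht).deriv, hderiv_deriv.deriv, mul_div_cancel_right₀ _ hne,
    mul_div_cancel_right₀ _ hne]
  exact ⟨rfl, rfl⟩

/-- Forward direction of the main theorem: the constructed quintet `(X, Y, Z, φ, V)`
satisfies the four Bianchi I field equations. -/
theorem stmt_1
    (K E a b : ℝ) (hK : 0 < K) (hE : E < 0)
    (P u : ℝ → ℝ) (hP : Continuous P)
    (hu : Differentiable ℝ u) (hu' : Differentiable ℝ (deriv u))
    (hSch : ∀ x, deriv (deriv u) x + (E - P x) * u x = 0)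
    (σ : ℝ → ℝ)
    (hσ : ∀ t ∈ Set.Ioo a b, HasDerivAt σ (u (σ t)) t)
    (hupos : ∀ t ∈ Set.Ioo a b, 0 < u (σ t))
    (ψ : ℝ → ℝ) (hψ : Differentiable ℝ ψ)
    (hψ' : ∀ x, (deriv ψ x) ^ 2 = 2 / (3 * K ^ 2) * P x)
    (c₁ c₂ : ℝ) (hc : c₁ ^ 2 + c₁ * c₂ + c₂ ^ 2 = -(4 * E) / 3)
    (X Y Z φ : ℝ → ℝ)
    (hXdef : ∀ t ∈ Set.Ioo a b, X t = (u (σ t)) ^ (-(1 : ℝ) / 3) * Real.exp (c₁ / 2 * σ t))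
    (hYdef : ∀ t ∈ Set.Ioo a b, Y t = (u (σ t)) ^ (-(1 : ℝ) / 3) * Real.exp (c₂ / 2 * σ t))
    (hZdef : ∀ t ∈ Set.Ioo a b, Z t = (u (σ t)) ^ (-(1 : ℝ) / 3) * Real.exp (-(c₁ / 2 * σ t) - c₂ / 2 * σ t))
    (hφdef : ∀ t, φ t = ψ (σ t))
    (W : ℝ → ℝ)
    (hW : ∀ t ∈ Set.Ioo a b, W t = 1 / (3 * K ^ 2) * ((deriv u (σ t)) ^ 2 + (u (σ t)) ^ 2 * (E - P (σ t))))
    (V : ℝ → ℝ)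
    (hV : ∀ t ∈ Set.Ioo a b, V (φ t) = W t)
    (ρ p : ℝ → ℝ)
    (hρ : ∀ t, ρ t = (deriv φ t) ^ 2 / 2 + V (φ t))
    (hp : ∀ t, p t = (deriv φ t) ^ 2 / 2 - V (φ t))
    :
    ∀ t ∈ Set.Ioo a b,
      ((deriv X t / X t) * (deriv Y t / Y t) + (deriv X t / X t) * (deriv Z t / Z t) + (deriv Y t / Y t) * (deriv Z t / Z t) = K ^ 2 * ρ t) ∧
      (deriv (deriv X) t / X t + deriv (deriv Y) t / Y t + (deriv X t / X t) * (deriv Y t / Y t) = -(K ^ 2 * p t)) ∧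
      (deriv (deriv X) t / X t + deriv (deriv Z) t / Z t + (deriv X t / X t) * (deriv Z t / Z t) = -(K ^ 2 * p t)) ∧
      (deriv (deriv Y) t / Y t + deriv (deriv Z) t / Z t + (deriv Y t / Y t) * (deriv Z t / Z t) = -(K ^ 2 * p t)) := by
  intro t ht
  have hZdef' : ∀ t ∈ Set.Ioo a b,
      Z t = (u (σ t)) ^ (-(1 : ℝ) / 3) * Real.exp ((-(c₁ / 2) - c₂ / 2) * σ t) := by
    intro s hs
    rw [hZdef s hs]
    ring_nf
  obtain ⟨hX₁, hX₂⟩ := scaleFactor_derivs hu hu' hSch hσ hupos hXdef ht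
  obtain ⟨hY₁, hY₂⟩ := scaleFactor_derivs hu hu' hSch hσ hupos hYdef ht
  obtain ⟨hZ₁, hZ₂⟩ := scaleFactor_derivs hu hu' hSch hσ hupos hZdef' ht
  have hφ : deriv φ t = deriv ψ (σ t) * u (σ t) := by
    rw [funext hφdef]
    exact ((hψ (σ t)).hasDerivAt.comp t (hσ t ht)).deriv
  have hkin : K ^ 2 * ((deriv φ t) ^ 2 / 2) = P (σ t) * u (σ t) ^ 2 / 3 := by
    rw [hφ, mul_pow, hψ']
    field_simp
  have hpot : K ^ 2 * V (φ t) =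
      ((deriv u (σ t)) ^ 2 + (u (σ t)) ^ 2 * (E - P (σ t))) / 3 := by
    rw [hV t ht, hW t ht]
    field_simp
  rw [hX₁, hX₂, hY₁, hY₂, hZ₁, hZ₂, hρ, hp]
  refine ⟨?_, ?_, ?_, ?_⟩
  · linear_combination -hkin - hpot - u (σ t) ^ 2 / 4 * hc
  all_goals linear_combination hkin - hpot + u (σ t) ^ 2 / 4 * hc
end

section
/- Under the forward-construction hypotheses, with θ = Ẋ/X + Ẏ/Y + Ż/Z built from the constructed functions X, Y, Z, the scalar field φ = ψ∘σ satisfies equation (3.12): φ̇(t)² = (2/(3K²))(−θ̇(t) + E/(X(t)²Y(t)²Z(t)²)) for all t ∈ I. -/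
open Filter Topology in
/-- Logarithmic derivative of `u(σ)^r e^g` along a solution of `σ̇ = u(σ)`. -/
theorem deriv_div_self_of_eventuallyEq_rpow_mul_exp {u σ g X : ℝ → ℝ} {r g' t : ℝ}
    (hu : DifferentiableAt ℝ u (σ t)) (hσ : HasDerivAt σ (u (σ t)) t) (hpos : 0 < u (σ t))
    (hg : HasDerivAt g g' t)
    (hX : X =ᶠ[𝓝 t] fun s => u (σ s) ^ r * Real.exp (g s)) :
    deriv X t / X t = r * deriv u (σ t) + g' := by
  have huσ : HasDerivAt (fun s => u (σ s)) (deriv u (σ t) * u (σ t)) t :=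
    hu.hasDerivAt.comp t hσ
  have h := (huσ.rpow_const (p := r) (Or.inl hpos.ne')).mul hg.exp
  have hd : deriv X t = _ := (h.congr_of_eventuallyEq hX).deriv
  rw [hd, hX.eq_of_nhds, Real.rpow_sub_one hpos.ne']
  have := (Real.rpow_pos_of_pos hpos r).ne'
  field_simp [hpos.ne']

/-- The product of the three scale factors has square `v⁻²`. -/
theorem sq_mul_sq_mul_sq_rpow_mul_exp {v : ℝ} (hv : 0 < v) (α β : ℝ) :
    (v ^ (-(1 : ℝ) / 3) * Real.exp α) ^ 2 * (v ^ (-(1 : ℝ) / 3) * Real.exp β) ^ 2 *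
      (v ^ (-(1 : ℝ) / 3) * Real.exp (-α - β)) ^ 2 = (v ^ 2)⁻¹ := by
  have h₁ : (v ^ (-(1 : ℝ) / 3)) ^ 3 = v⁻¹ := by
    rw [← Real.rpow_natCast, ← Real.rpow_mul hv.le, ← Real.rpow_neg_one]
    norm_num
  have h₂ : Real.exp α * Real.exp β * Real.exp (-α - β) = 1 := by
    rw [← Real.exp_add, ← Real.exp_add]
    simp
  calc _ = ((v ^ (-(1 : ℝ) / 3)) ^ 3 * (Real.exp α * Real.exp β * Real.exp (-α - β))) ^ 2 := by
        ring
    _ = (v ^ 2)⁻¹ := by rw [h₁, h₂, mul_one, inv_pow]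

/-- Equation (3.12): the constructed scalar field satisfies
`φ̇² = (2/(3K²))(−θ̇ + E/(X²Y²Z²))`. -/
theorem stmt_2
    (K E a b : ℝ) (hK : 0 < K) (hE : E < 0)
    (P u : ℝ → ℝ) (hP : Continuous P)
    (hu : Differentiable ℝ u) (hu' : Differentiable ℝ (deriv u))
    (hSch : ∀ x, deriv (deriv u) x + (E - P x) * u x = 0)
    (σ : ℝ → ℝ)
    (hσ : ∀ t ∈ Set.Ioo a b, HasDerivAt σ (u (σ t)) t)
    (hupos : ∀ t ∈ Set.Ioo a b, 0 < u (σ t))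
    (ψ : ℝ → ℝ) (hψ : Differentiable ℝ ψ)
    (hψ' : ∀ x, (deriv ψ x) ^ 2 = 2 / (3 * K ^ 2) * P x)
    (c₁ c₂ : ℝ) (hc : c₁ ^ 2 + c₁ * c₂ + c₂ ^ 2 = -(4 * E) / 3)
    (X Y Z φ : ℝ → ℝ)
    (hXdef : ∀ t ∈ Set.Ioo a b, X t = (u (σ t)) ^ (-(1 : ℝ) / 3) * Real.exp (c₁ / 2 * σ t))
    (hYdef : ∀ t ∈ Set.Ioo a b, Y t = (u (σ t)) ^ (-(1 : ℝ) / 3) * Real.exp (c₂ / 2 * σ t))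
    (hZdef : ∀ t ∈ Set.Ioo a b, Z t = (u (σ t)) ^ (-(1 : ℝ) / 3) * Real.exp (-(c₁ / 2 * σ t) - c₂ / 2 * σ t))
    (hφdef : ∀ t, φ t = ψ (σ t))
    (θ : ℝ → ℝ)
    (hθ : ∀ t ∈ Set.Ioo a b, θ t = deriv X t / X t + deriv Y t / Y t + deriv Z t / Z t)
    :
    ∀ t ∈ Set.Ioo a b,
      (deriv φ t) ^ 2 =
        2 / (3 * K ^ 2) * (-(deriv θ t) + E / (X t ^ 2 * Y t ^ 2 * Z t ^ 2)) := by
  intro t ht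
  have hmem : ∀ s ∈ Set.Ioo a b, Set.Ioo a b ∈ nhds s := fun s hs => isOpen_Ioo.mem_nhds hs
  have hθu : ∀ s ∈ Set.Ioo a b, θ s = -deriv u (σ s) := by
    intro s hs
    have hα := (hσ s hs).const_mul (c₁ / 2)
    have hβ := (hσ s hs).const_mul (c₂ / 2)
    rw [hθ s hs,
      deriv_div_self_of_eventuallyEq_rpow_mul_exp (hu _) (hσ s hs) (hupos s hs) hα
        (Filter.eventually_of_mem (hmem s hs) hXdef),
      deriv_div_self_of_eventuallyEq_rpow_mul_exp (hu _) (hσ s hs) (hupos s hs) hβ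
        (Filter.eventually_of_mem (hmem s hs) hYdef),
      deriv_div_self_of_eventuallyEq_rpow_mul_exp (hu _) (hσ s hs) (hupos s hs) (hα.neg.sub hβ)
        (Filter.eventually_of_mem (hmem s hs) hZdef)]
    ring
  have hθ' : deriv θ t = -(deriv (deriv u) (σ t) * u (σ t)) :=
    (((hu' (σ t)).hasDerivAt.comp t (hσ t ht)).neg.congr_of_eventuallyEq
      (Filter.eventually_of_mem (hmem t ht) hθu)).deriv
  have hφ' : deriv φ t = deriv ψ (σ t) * u (σ t) := by
    rw [funext hφdef]
    exact ((hψ (σ t)).hasDerivAt.comp t (hσ t ht)).deriv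
  rw [hXdef t ht, hYdef t ht, hZdef t ht, sq_mul_sq_mul_sq_rpow_mul_exp (hupos t ht), div_inv_eq_mul,
    hθ', hφ', mul_pow, hψ']
  linear_combination (-(2 / (3 * K ^ 2)) * u (σ t)) * hSch (σ t)
end

section
/- Under the forward-construction hypotheses, with θ = Ẋ/X + Ẏ/Y + Ż/Z built from the constructed functions X, Y, Z, equation (3.13) holds: W(t) = (1/(3K²))(θ(t)² + θ̇(t)) for all t ∈ I, where W(t) = (1/(3K²))[u'(σ(t))² + u(σ(t))²(E − P(σ(t)))]. -/
/-- The logarithmic derivative of `u(σ)^(-1/3) * exp (c * σ)` along a solution of `σ̇ = u(σ)`. -/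
theorem deriv_div_self_of_eqOn_rpow_mul_exp {u σ f : ℝ → ℝ} {s : Set ℝ} {c t : ℝ}
    (hs : s ∈ nhds t) (hu : DifferentiableAt ℝ u (σ t)) (hσ : HasDerivAt σ (u (σ t)) t)
    (hpos : 0 < u (σ t))
    (hf : ∀ r ∈ s, f r = (u (σ r)) ^ (-(1 : ℝ) / 3) * Real.exp (c * σ r)) :
    deriv f t / f t = -(1 : ℝ) / 3 * deriv u (σ t) + c * u (σ t) := by
  have hcomp : HasDerivAt (fun r => u (σ r)) (deriv u (σ t) * u (σ t)) t :=
    hu.hasDerivAt.comp t hσ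
  have hprod := (hcomp.rpow_const (p := -(1 : ℝ) / 3) (Or.inl hpos.ne')).mul
    (hσ.const_mul c).exp
  have hfd := hprod.congr_of_eventuallyEq (Filter.eventuallyEq_of_mem hs hf)
  rw [hfd.deriv, hf t (mem_of_mem_nhds hs), Real.rpow_sub_one hpos.ne']
  have hR : (u (σ t)) ^ (-(1 : ℝ) / 3) ≠ 0 := (Real.rpow_pos_of_pos hpos _).ne'
  have hne := hpos.ne'
  generalize (u (σ t)) ^ (-(1 : ℝ) / 3) = R at hR ⊢
  field_simp

/-- Equation (3.13): `W = (1/(3K²))(θ² + θ̇)` for the constructed functions, where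
`W(t) = (1/(3K²))[u'(σ(t))² + u(σ(t))²(E − P(σ(t)))]`. -/
theorem stmt_3
    (K E a b : ℝ) (hK : 0 < K) (hE : E < 0)
    (P u : ℝ → ℝ) (hP : Continuous P)
    (hu : Differentiable ℝ u) (hu' : Differentiable ℝ (deriv u))
    (hSch : ∀ x, deriv (deriv u) x + (E - P x) * u x = 0)
    (σ : ℝ → ℝ)
    (hσ : ∀ t ∈ Set.Ioo a b, HasDerivAt σ (u (σ t)) t)
    (hupos : ∀ t ∈ Set.Ioo a b, 0 < u (σ t))
    (c₁ c₂ : ℝ) (hc : c₁ ^ 2 + c₁ * c₂ + c₂ ^ 2 = -(4 * E) / 3)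
    (X Y Z : ℝ → ℝ)
    (hXdef : ∀ t ∈ Set.Ioo a b, X t = (u (σ t)) ^ (-(1 : ℝ) / 3) * Real.exp (c₁ / 2 * σ t))
    (hYdef : ∀ t ∈ Set.Ioo a b, Y t = (u (σ t)) ^ (-(1 : ℝ) / 3) * Real.exp (c₂ / 2 * σ t))
    (hZdef : ∀ t ∈ Set.Ioo a b, Z t = (u (σ t)) ^ (-(1 : ℝ) / 3) * Real.exp (-(c₁ / 2 * σ t) - c₂ / 2 * σ t))
    (W : ℝ → ℝ)
    (hW : ∀ t ∈ Set.Ioo a b, W t = 1 / (3 * K ^ 2) * ((deriv u (σ t)) ^ 2 + (u (σ t)) ^ 2 * (E - P (σ t))))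
    (θ : ℝ → ℝ)
    (hθ : ∀ t ∈ Set.Ioo a b, θ t = deriv X t / X t + deriv Y t / Y t + deriv Z t / Z t)
    :
    ∀ t ∈ Set.Ioo a b, W t = 1 / (3 * K ^ 2) * (θ t ^ 2 + deriv θ t) := by
  have hθu : ∀ t ∈ Set.Ioo a b, θ t = -deriv u (σ t) := by
    intro t ht
    have hs : Set.Ioo a b ∈ nhds t := isOpen_Ioo.mem_nhds ht
    have hZ : ∀ r ∈ Set.Ioo a b, Z r =
        (u (σ r)) ^ (-(1 : ℝ) / 3) * Real.exp ((-(c₁ / 2) - c₂ / 2) * σ r) := by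
      intro r hr
      rw [hZdef r hr]
      ring_nf
    rw [hθ t ht,
      deriv_div_self_of_eqOn_rpow_mul_exp hs (hu _) (hσ t ht) (hupos t ht) hXdef,
      deriv_div_self_of_eqOn_rpow_mul_exp hs (hu _) (hσ t ht) (hupos t ht) hYdef,
      deriv_div_self_of_eqOn_rpow_mul_exp hs (hu _) (hσ t ht) (hupos t ht) hZ]
    ring
  intro t ht
  have hcomp : HasDerivAt (fun r => -deriv u (σ r)) (-(deriv (deriv u) (σ t) * u (σ t))) t :=
    ((hu' (σ t)).hasDerivAt.comp t (hσ t ht)).neg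
  have hθd := hcomp.congr_of_eventuallyEq
    (Filter.eventuallyEq_of_mem (isOpen_Ioo.mem_nhds ht) hθu)
  rw [hW t ht, hθd.deriv, hθu t ht]
  linear_combination (1 / (3 * K ^ 2) * u (σ t)) * hSch (σ t)
end

section
/- Let (X, Y, Z, φ, V) be a solution of the Bianchi I field equations (i)-(iv) on an open interval I, let σ : I → ℝ be differentiable with σ̇(t) = 1/(X(t)Y(t)Z(t)), and let E = −(1/2)X(t₀)²Y(t₀)²Z(t₀)²(η₁(t₀)² + η₂(t₀)² + η₃(t₀)²) for some fixed t₀ ∈ I. Suppose u : ℝ → ℝ is twice differentiable with u(σ(t)) = 1/(X(t)Y(t)Z(t)) for all t ∈ I, and P : ℝ → ℝ satisfies P(σ(t)) = (3K²/2)φ̇(t)²X(t)²Y(t)²Z(t)² for all t ∈ I. Then the time-independent linear Schrödinger equation holds along σ: u''(σ(t)) + (E − P(σ(t)))u(σ(t)) = 0 for all t ∈ I. -/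
/-- If two scale factors satisfy the difference of two Bianchi I equations, the volume times the
difference of their logarithmic derivatives is constant. -/
lemma volume_mul_shear_eq {a b : ℝ} {X Y Z : ℝ → ℝ}
    (hX1 : ∀ t ∈ Set.Ioo a b, DifferentiableAt ℝ X t)
    (hX2 : ∀ t ∈ Set.Ioo a b, DifferentiableAt ℝ (deriv X) t)
    (hY1 : ∀ t ∈ Set.Ioo a b, DifferentiableAt ℝ Y t)
    (hY2 : ∀ t ∈ Set.Ioo a b, DifferentiableAt ℝ (deriv Y) t)
    (hZ1 : ∀ t ∈ Set.Ioo a b, DifferentiableAt ℝ Z t)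
    (hX0 : ∀ t ∈ Set.Ioo a b, X t ≠ 0)
    (hY0 : ∀ t ∈ Set.Ioo a b, Y t ≠ 0)
    (hZ0 : ∀ t ∈ Set.Ioo a b, Z t ≠ 0)
    (h : ∀ t ∈ Set.Ioo a b,
      deriv (deriv X) t / X t + (deriv X t / X t) * (deriv Z t / Z t) =
        deriv (deriv Y) t / Y t + (deriv Y t / Y t) * (deriv Z t / Z t))
    {s t : ℝ} (hs : s ∈ Set.Ioo a b) (ht : t ∈ Set.Ioo a b) :
    X s * Y s * Z s * (deriv X s / X s - deriv Y s / Y s) =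
      X t * Y t * Z t * (deriv X t / X t - deriv Y t / Y t) := by
  have hd : ∀ r ∈ Set.Ioo a b,
      HasDerivAt (fun r => (deriv X r * Y r - X r * deriv Y r) * Z r) 0 r := by
    intro r hr
    have hX := hX0 r hr
    have hY := hY0 r hr
    have hZ := hZ0 r hr
    have hder := (((hX2 r hr).hasDerivAt.mul (hY1 r hr).hasDerivAt).sub
      ((hX1 r hr).hasDerivAt.mul (hY2 r hr).hasDerivAt)).mul (hZ1 r hr).hasDerivAt
    refine hder.congr_deriv ?_
    have e := h r hr
    field_simp at e
    simp only [Pi.sub_apply, Pi.mul_apply]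
    linear_combination e
  have hc := isOpen_Ioo.is_const_of_deriv_eq_zero isPreconnected_Ioo
    (fun r hr => (hd r hr).differentiableAt.differentiableWithinAt)
    (fun r hr => (hd r hr).deriv) hs ht
  have hform : ∀ r ∈ Set.Ioo a b, X r * Y r * Z r * (deriv X r / X r - deriv Y r / Y r) =
      (deriv X r * Y r - X r * deriv Y r) * Z r := by
    intro r hr
    have hX := hX0 r hr
    have hY := hY0 r hr
    field_simp
  rw [hform s hs, hform t ht]
  exact hc

/-- The derivative of a logarithmic derivative. -/
lemma hasDerivAt_deriv_div_self {X : ℝ → ℝ} {t : ℝ} (h1 : DifferentiableAt ℝ X t)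
    (h2 : DifferentiableAt ℝ (deriv X) t) (h0 : X t ≠ 0) :
    HasDerivAt (fun s => deriv X s / X s)
      (deriv (deriv X) t / X t - (deriv X t / X t) ^ 2) t := by
  refine (h2.hasDerivAt.div h1.hasDerivAt h0).congr_deriv ?_
  field_simp

/-- If `f ∘ σ = g` on an open interval, the chain rule computes `f'` along `σ`. -/
lemma deriv_comp_mul_eq {a b t f' s' : ℝ} {f g σ : ℝ → ℝ} (hf : Differentiable ℝ f)
    (hfg : ∀ s ∈ Set.Ioo a b, f (σ s) = g s) (ht : t ∈ Set.Ioo a b)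
    (hσ : HasDerivAt σ s' t) (hg : HasDerivAt g f' t) :
    deriv f (σ t) * s' = f' := by
  have hcomp : HasDerivAt (fun s => f (σ s)) (deriv f (σ t) * s') t :=
    (hf (σ t)).hasDerivAt.comp t hσ
  refine hcomp.unique (hg.congr_of_eventuallyEq ?_)
  filter_upwards [isOpen_Ioo.mem_nhds ht] with s hs using hfg s hs

/-- Converse direction: from a Bianchi I solution one obtains a solution of the
time-independent linear Schrödinger equation along `σ`. -/
theorem stmt_4
    (K a b : ℝ) (hK : 0 < K)
    (X Y Z φ : ℝ → ℝ) (V : ℝ → ℝ)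
    (hX1 : ∀ t ∈ Set.Ioo a b, DifferentiableAt ℝ X t)
    (hX2 : ∀ t ∈ Set.Ioo a b, DifferentiableAt ℝ (deriv X) t)
    (hY1 : ∀ t ∈ Set.Ioo a b, DifferentiableAt ℝ Y t)
    (hY2 : ∀ t ∈ Set.Ioo a b, DifferentiableAt ℝ (deriv Y) t)
    (hZ1 : ∀ t ∈ Set.Ioo a b, DifferentiableAt ℝ Z t)
    (hZ2 : ∀ t ∈ Set.Ioo a b, DifferentiableAt ℝ (deriv Z) t)
    (hφ1 : ∀ t ∈ Set.Ioo a b, DifferentiableAt ℝ φ t)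
    (hφ2 : ∀ t ∈ Set.Ioo a b, DifferentiableAt ℝ (deriv φ) t)
    (hXpos : ∀ t ∈ Set.Ioo a b, 0 < X t)
    (hYpos : ∀ t ∈ Set.Ioo a b, 0 < Y t)
    (hZpos : ∀ t ∈ Set.Ioo a b, 0 < Z t)
    (ρ p : ℝ → ℝ)
    (hρ : ∀ t, ρ t = (deriv φ t) ^ 2 / 2 + V (φ t))
    (hp : ∀ t, p t = (deriv φ t) ^ 2 / 2 - V (φ t))
    (heqi : ∀ t ∈ Set.Ioo a b, (deriv X t / X t) * (deriv Y t / Y t) + (deriv X t / X t) * (deriv Z t / Z t) + (deriv Y t / Y t) * (deriv Z t / Z t) = K ^ 2 * ρ t)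
    (heqii : ∀ t ∈ Set.Ioo a b, deriv (deriv X) t / X t + deriv (deriv Y) t / Y t + (deriv X t / X t) * (deriv Y t / Y t) = -(K ^ 2 * p t))
    (heqiii : ∀ t ∈ Set.Ioo a b, deriv (deriv X) t / X t + deriv (deriv Z) t / Z t + (deriv X t / X t) * (deriv Z t / Z t) = -(K ^ 2 * p t))
    (heqiv : ∀ t ∈ Set.Ioo a b, deriv (deriv Y) t / Y t + deriv (deriv Z) t / Z t + (deriv Y t / Y t) * (deriv Z t / Z t) = -(K ^ 2 * p t))
    (η₁ η₂ η₃ : ℝ → ℝ)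
    (hη₁ : ∀ t ∈ Set.Ioo a b, η₁ t = deriv X t / X t - deriv Y t / Y t)
    (hη₂ : ∀ t ∈ Set.Ioo a b, η₂ t = deriv X t / X t - deriv Z t / Z t)
    (hη₃ : ∀ t ∈ Set.Ioo a b, η₃ t = deriv Y t / Y t - deriv Z t / Z t)
    (σ : ℝ → ℝ)
    (hσ : ∀ t ∈ Set.Ioo a b, HasDerivAt σ (1 / (X t * Y t * Z t)) t)
    (t₀ : ℝ) (ht₀ : t₀ ∈ Set.Ioo a b)
    (E : ℝ)
    (hEdef : E = -(1 / 2) * (X t₀ ^ 2 * Y t₀ ^ 2 * Z t₀ ^ 2 * (η₁ t₀ ^ 2 + η₂ t₀ ^ 2 + η₃ t₀ ^ 2)))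
    (u : ℝ → ℝ)
    (hu : Differentiable ℝ u) (hu' : Differentiable ℝ (deriv u))
    (huσ : ∀ t ∈ Set.Ioo a b, u (σ t) = 1 / (X t * Y t * Z t))
    (P : ℝ → ℝ)
    (hPσ : ∀ t ∈ Set.Ioo a b, P (σ t) = 3 * K ^ 2 / 2 * ((deriv φ t) ^ 2 * X t ^ 2 * Y t ^ 2 * Z t ^ 2))
    :
    ∀ t ∈ Set.Ioo a b, deriv (deriv u) (σ t) + (E - P (σ t)) * u (σ t) = 0 := by
  have hX0 := fun t ht => (hXpos t ht).ne'
  have hY0 := fun t ht => (hYpos t ht).ne'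
  have hZ0 := fun t ht => (hZpos t ht).ne'
  have hu1 : ∀ t ∈ Set.Ioo a b,
      deriv u (σ t) = -(deriv X t / X t + deriv Y t / Y t + deriv Z t / Z t) := by
    intro t ht
    have hX := hX0 t ht
    have hY := hY0 t ht
    have hZ := hZ0 t ht
    have hW := ((hX1 t ht).hasDerivAt.mul (hY1 t ht).hasDerivAt).mul (hZ1 t ht).hasDerivAt
    have hinv := hW.inv (mul_ne_zero (mul_ne_zero hX hY) hZ)
    have e := deriv_comp_mul_eq hu (fun s hs => (huσ s hs).trans (one_div _)) ht (hσ t ht) hinv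
    simp only [Pi.mul_apply] at e
    field_simp at e ⊢
    linear_combination e
  intro t ht
  have hX := hX0 t ht
  have hY := hY0 t ht
  have hZ := hZ0 t ht
  have hu2 := deriv_comp_mul_eq hu' hu1 ht (hσ t ht)
    (((hasDerivAt_deriv_div_self (hX1 t ht) (hX2 t ht) hX).add
      (hasDerivAt_deriv_div_self (hY1 t ht) (hY2 t ht) hY)).add
      (hasDerivAt_deriv_div_self (hZ1 t ht) (hZ2 t ht) hZ)).neg
  have c1 := volume_mul_shear_eq hX1 hX2 hY1 hY2 hZ1 hX0 hY0 hZ0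
    (fun s hs => by linear_combination heqiii s hs - heqiv s hs) ht₀ ht
  have c2 := volume_mul_shear_eq hX1 hX2 hZ1 hZ2 hY1 hX0 hZ0 hY0
    (fun s hs => by linear_combination heqii s hs - heqiv s hs) ht₀ ht
  have c3 := volume_mul_shear_eq hY1 hY2 hZ1 hZ2 hX1 hY0 hZ0 hX0
    (fun s hs => by linear_combination heqii s hs - heqiii s hs) ht₀ ht
  have hE : E = -(1 / 2) * (X t * Y t * Z t) ^ 2 *
      ((deriv X t / X t - deriv Y t / Y t) ^ 2 + (deriv X t / X t - deriv Z t / Z t) ^ 2 +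
        (deriv Y t / Y t - deriv Z t / Z t) ^ 2) := by
    rw [hEdef, hη₁ t₀ ht₀, hη₂ t₀ ht₀, hη₃ t₀ ht₀]
    have d1 := congrArg (· ^ 2) c1
    have d2 := congrArg (· ^ 2) c2
    have d3 := congrArg (· ^ 2) c3
    linear_combination -(1 / 2) * (d1 + d2 + d3)
  have e1 := heqi t ht
  have e2 := heqii t ht
  have e3 := heqiii t ht
  have e4 := heqiv t ht
  rw [hρ] at e1
  rw [hp] at e2 e3 e4
  rw [hE, hPσ t ht, huσ t ht]
  generalize deriv X t / X t = A at *
  generalize deriv Y t / Y t = B at *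
  generalize deriv Z t / Z t = C at *
  generalize deriv (deriv X) t / X t = A₂ at *
  generalize deriv (deriv Y) t / Y t = B₂ at *
  generalize deriv (deriv Z) t / Z t = C₂ at *
  have hW : X t * Y t * Z t ≠ 0 := mul_ne_zero (mul_ne_zero hX hY) hZ
  have hu3 : deriv (deriv u) (σ t) =
      -(A₂ - A ^ 2 + (B₂ - B ^ 2) + (C₂ - C ^ 2)) * (X t * Y t * Z t) := by
    rw [← hu2]
    field_simp
  rw [hu3]
  field_simp
  linear_combination X t * Y t * Z t * (3 * e1 - (e2 + e3 + e4))
end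

section
/- Let (X, Y, Z, φ, V) be a solution of the Bianchi I field equations (i)-(iv) on an open interval I. Then the function t ↦ X(t)²Y(t)²Z(t)²(η₁(t)² + η₂(t)² + η₃(t)²) is constant on I and nonnegative; consequently the energy E := −(1/2)X²Y²Z²(η₁² + η₂² + η₃²) is a constant with E ≤ 0. -/
/-- If `f, g, h` are twice differentiable on an interval and
`f''/f + f'h'/(fh) = g''/g + g'h'/(gh)`, then `fgh (f'/f - g'/g)` is constant there. -/
theorem exists_mul_logDeriv_sub_eq_const {a b : ℝ} {f g h : ℝ → ℝ}
    (hf1 : ∀ t ∈ Set.Ioo a b, DifferentiableAt ℝ f t)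
    (hf2 : ∀ t ∈ Set.Ioo a b, DifferentiableAt ℝ (deriv f) t)
    (hg1 : ∀ t ∈ Set.Ioo a b, DifferentiableAt ℝ g t)
    (hg2 : ∀ t ∈ Set.Ioo a b, DifferentiableAt ℝ (deriv g) t)
    (hh1 : ∀ t ∈ Set.Ioo a b, DifferentiableAt ℝ h t)
    (hf0 : ∀ t ∈ Set.Ioo a b, f t ≠ 0) (hg0 : ∀ t ∈ Set.Ioo a b, g t ≠ 0)
    (hh0 : ∀ t ∈ Set.Ioo a b, h t ≠ 0)
    (heq : ∀ t ∈ Set.Ioo a b,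
      deriv (deriv f) t / f t + (deriv f t / f t) * (deriv h t / h t) =
        deriv (deriv g) t / g t + (deriv g t / g t) * (deriv h t / h t)) :
    ∃ c : ℝ, ∀ t ∈ Set.Ioo a b,
      f t * g t * h t * (deriv f t / f t - deriv g t / g t) = c := by
  have hderiv : ∀ t ∈ Set.Ioo a b,
      HasDerivAt (fun s => (deriv f s * g s - f s * deriv g s) * h s) 0 t := by
    intro t ht
    have hf := (hf1 t ht).hasDerivAt
    have hg := (hg1 t ht).hasDerivAt
    refine ((((hf2 t ht).hasDerivAt.fun_mul hg).fun_sub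
      (hf.fun_mul (hg2 t ht).hasDerivAt)).fun_mul (hh1 t ht).hasDerivAt).congr_deriv ?_
    have e := heq t ht
    have := hf0 t ht
    have := hg0 t ht
    have := hh0 t ht
    field_simp at e
    linear_combination e
  obtain ⟨c, hc⟩ := isOpen_Ioo.exists_is_const_of_deriv_eq_zero isPreconnected_Ioo
    (fun t ht => (hderiv t ht).differentiableAt.differentiableWithinAt)
    (fun t ht => (hderiv t ht).deriv)
  refine ⟨c, fun t ht => ?_⟩
  rw [← hc t ht]
  have := hf0 t ht
  have := hg0 t ht
  field_simp

/-- For a Bianchi I solution, `X²Y²Z²(η₁² + η₂² + η₃²)` is a nonnegative constant on `I`;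
hence `E := −(1/2)X²Y²Z²(η₁² + η₂² + η₃²)` is a constant with `E ≤ 0`. -/
theorem stmt_5
    (K a b : ℝ) (hK : 0 < K)
    (X Y Z φ : ℝ → ℝ) (V : ℝ → ℝ)
    (hX1 : ∀ t ∈ Set.Ioo a b, DifferentiableAt ℝ X t)
    (hX2 : ∀ t ∈ Set.Ioo a b, DifferentiableAt ℝ (deriv X) t)
    (hY1 : ∀ t ∈ Set.Ioo a b, DifferentiableAt ℝ Y t)
    (hY2 : ∀ t ∈ Set.Ioo a b, DifferentiableAt ℝ (deriv Y) t)
    (hZ1 : ∀ t ∈ Set.Ioo a b, DifferentiableAt ℝ Z t)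
    (hZ2 : ∀ t ∈ Set.Ioo a b, DifferentiableAt ℝ (deriv Z) t)
    (hφ1 : ∀ t ∈ Set.Ioo a b, DifferentiableAt ℝ φ t)
    (hφ2 : ∀ t ∈ Set.Ioo a b, DifferentiableAt ℝ (deriv φ) t)
    (hXpos : ∀ t ∈ Set.Ioo a b, 0 < X t)
    (hYpos : ∀ t ∈ Set.Ioo a b, 0 < Y t)
    (hZpos : ∀ t ∈ Set.Ioo a b, 0 < Z t)
    (ρ p : ℝ → ℝ)
    (hρ : ∀ t, ρ t = (deriv φ t) ^ 2 / 2 + V (φ t))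
    (hp : ∀ t, p t = (deriv φ t) ^ 2 / 2 - V (φ t))
    (heqi : ∀ t ∈ Set.Ioo a b, (deriv X t / X t) * (deriv Y t / Y t) + (deriv X t / X t) * (deriv Z t / Z t) + (deriv Y t / Y t) * (deriv Z t / Z t) = K ^ 2 * ρ t)
    (heqii : ∀ t ∈ Set.Ioo a b, deriv (deriv X) t / X t + deriv (deriv Y) t / Y t + (deriv X t / X t) * (deriv Y t / Y t) = -(K ^ 2 * p t))
    (heqiii : ∀ t ∈ Set.Ioo a b, deriv (deriv X) t / X t + deriv (deriv Z) t / Z t + (deriv X t / X t) * (deriv Z t / Z t) = -(K ^ 2 * p t))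
    (heqiv : ∀ t ∈ Set.Ioo a b, deriv (deriv Y) t / Y t + deriv (deriv Z) t / Z t + (deriv Y t / Y t) * (deriv Z t / Z t) = -(K ^ 2 * p t))
    (η₁ η₂ η₃ : ℝ → ℝ)
    (hη₁ : ∀ t ∈ Set.Ioo a b, η₁ t = deriv X t / X t - deriv Y t / Y t)
    (hη₂ : ∀ t ∈ Set.Ioo a b, η₂ t = deriv X t / X t - deriv Z t / Z t)
    (hη₃ : ∀ t ∈ Set.Ioo a b, η₃ t = deriv Y t / Y t - deriv Z t / Z t)
    :
    (∃ c : ℝ, 0 ≤ c ∧ ∀ t ∈ Set.Ioo a b,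
        X t ^ 2 * Y t ^ 2 * Z t ^ 2 * (η₁ t ^ 2 + η₂ t ^ 2 + η₃ t ^ 2) = c) ∧
    (∃ E : ℝ, E ≤ 0 ∧ ∀ t ∈ Set.Ioo a b,
        -(1 / 2) * (X t ^ 2 * Y t ^ 2 * Z t ^ 2 * (η₁ t ^ 2 + η₂ t ^ 2 + η₃ t ^ 2)) = E) := by
  have hX0 := fun t ht => (hXpos t ht).ne'
  have hY0 := fun t ht => (hYpos t ht).ne'
  have hZ0 := fun t ht => (hZpos t ht).ne'
  obtain ⟨c₁, h₁⟩ := exists_mul_logDeriv_sub_eq_const hX1 hX2 hY1 hY2 hZ1 hX0 hY0 hZ0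
    (fun t ht => by linear_combination heqiii t ht - heqiv t ht)
  obtain ⟨c₂, h₂⟩ := exists_mul_logDeriv_sub_eq_const hX1 hX2 hZ1 hZ2 hY1 hX0 hZ0 hY0
    (fun t ht => by linear_combination heqii t ht - heqiv t ht)
  obtain ⟨c₃, h₃⟩ := exists_mul_logDeriv_sub_eq_const hY1 hY2 hZ1 hZ2 hX1 hY0 hZ0 hX0
    (fun t ht => by linear_combination heqii t ht - heqiii t ht)
  have key : ∀ t ∈ Set.Ioo a b,
      X t ^ 2 * Y t ^ 2 * Z t ^ 2 * (η₁ t ^ 2 + η₂ t ^ 2 + η₃ t ^ 2) =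
        c₁ ^ 2 + c₂ ^ 2 + c₃ ^ 2 := by
    intro t ht
    rw [hη₁ t ht, hη₂ t ht, hη₃ t ht, ← h₁ t ht, ← h₂ t ht, ← h₃ t ht]
    ring
  refine ⟨⟨_, by positivity, key⟩, -(1 / 2) * (c₁ ^ 2 + c₂ ^ 2 + c₃ ^ 2), ?_, fun t ht => ?_⟩
  · nlinarith [sq_nonneg c₁, sq_nonneg c₂, sq_nonneg c₃]
  · rw [key t ht]
end

section
/- Let (X, Y, Z, φ, V) be a solution of the Bianchi I field equations (i)-(iv) on an open interval I. Then for each i = 1, 2, 3, the anisotropy function η_i satisfies η̇_i(t) + θ(t)η_i(t) = 0 for all t ∈ I; equivalently, each product X·Y·Z·η_i is a constant function on I. -/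
/-- If two scale factors `U`, `W` satisfy `U''/U + (U'/U)(T'/T) = W''/W + (W'/W)(T'/T)`, then the
difference `η` of their Hubble rates satisfies `η' = -(U'/U + W'/W + T'/T) η`. -/
lemma hasDerivAt_hubble_sub {s : Set ℝ} (hs : IsOpen s) {U W T η : ℝ → ℝ} {t : ℝ} (ht : t ∈ s)
    (hU : DifferentiableAt ℝ U t) (hU' : DifferentiableAt ℝ (deriv U) t)
    (hW : DifferentiableAt ℝ W t) (hW' : DifferentiableAt ℝ (deriv W) t)
    (hU0 : U t ≠ 0) (hW0 : W t ≠ 0)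
    (hη : ∀ t ∈ s, η t = deriv U t / U t - deriv W t / W t)
    (h : deriv (deriv U) t / U t + deriv U t / U t * (deriv T t / T t) =
      deriv (deriv W) t / W t + deriv W t / W t * (deriv T t / T t)) :
    HasDerivAt η (-((deriv U t / U t + deriv W t / W t + deriv T t / T t) * η t)) t := by
  have hd := (hU'.hasDerivAt.div hU.hasDerivAt hU0).sub (hW'.hasDerivAt.div hW.hasDerivAt hW0)
  have hd' := hd.congr_of_eventuallyEq (f₁ := η) (by
    filter_upwards [hs.mem_nhds ht] with x hx
    exact hη x hx)
  refine hd'.congr_deriv ?_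
  have quot_rule (f : ℝ → ℝ) (hf : f t ≠ 0) :
      (deriv (deriv f) t * f t - deriv f t * deriv f t) / f t ^ 2 =
        deriv (deriv f) t / f t - (deriv f t / f t) ^ 2 := by
    field_simp
  rw [quot_rule U hU0, quot_rule W hW0, hη t ht]
  linear_combination h

/-- If `η' = -(X'/X + Y'/Y + Z'/Z) η` on an open interval, then `X Y Z η` is constant there. -/
lemma exists_volume_mul_eq_const {a b : ℝ} {X Y Z η : ℝ → ℝ}
    (hX : ∀ t ∈ Set.Ioo a b, DifferentiableAt ℝ X t)
    (hY : ∀ t ∈ Set.Ioo a b, DifferentiableAt ℝ Y t)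
    (hZ : ∀ t ∈ Set.Ioo a b, DifferentiableAt ℝ Z t)
    (hX0 : ∀ t ∈ Set.Ioo a b, X t ≠ 0)
    (hY0 : ∀ t ∈ Set.Ioo a b, Y t ≠ 0)
    (hZ0 : ∀ t ∈ Set.Ioo a b, Z t ≠ 0)
    (hη : ∀ t ∈ Set.Ioo a b,
      HasDerivAt η (-((deriv X t / X t + deriv Y t / Y t + deriv Z t / Z t) * η t)) t) :
    ∃ k : ℝ, ∀ t ∈ Set.Ioo a b, X t * Y t * Z t * η t = k := by
  have hd : ∀ t ∈ Set.Ioo a b, HasDerivAt (fun t ↦ X t * Y t * Z t * η t) 0 t := by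
    intro t ht
    have hprod := (((hX t ht).hasDerivAt.mul (hY t ht).hasDerivAt).mul
      (hZ t ht).hasDerivAt).mul (hη t ht)
    refine hprod.congr_deriv ?_
    have := hX0 t ht
    have := hY0 t ht
    have := hZ0 t ht
    simp only [Pi.mul_apply]
    field_simp
    ring
  exact isOpen_Ioo.exists_is_const_of_deriv_eq_zero isPreconnected_Ioo
    (fun t ht ↦ (hd t ht).differentiableAt.differentiableWithinAt) (fun t ht ↦ (hd t ht).deriv)

/-- For a Bianchi I solution, each anisotropy function satisfies `η̇ᵢ + θ ηᵢ = 0`;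
equivalently each product `X·Y·Z·ηᵢ` is constant on `I`. -/
theorem stmt_6
    (K a b : ℝ) (hK : 0 < K)
    (X Y Z φ : ℝ → ℝ) (V : ℝ → ℝ)
    (hX1 : ∀ t ∈ Set.Ioo a b, DifferentiableAt ℝ X t)
    (hX2 : ∀ t ∈ Set.Ioo a b, DifferentiableAt ℝ (deriv X) t)
    (hY1 : ∀ t ∈ Set.Ioo a b, DifferentiableAt ℝ Y t)
    (hY2 : ∀ t ∈ Set.Ioo a b, DifferentiableAt ℝ (deriv Y) t)
    (hZ1 : ∀ t ∈ Set.Ioo a b, DifferentiableAt ℝ Z t)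
    (hZ2 : ∀ t ∈ Set.Ioo a b, DifferentiableAt ℝ (deriv Z) t)
    (hφ1 : ∀ t ∈ Set.Ioo a b, DifferentiableAt ℝ φ t)
    (hφ2 : ∀ t ∈ Set.Ioo a b, DifferentiableAt ℝ (deriv φ) t)
    (hXpos : ∀ t ∈ Set.Ioo a b, 0 < X t)
    (hYpos : ∀ t ∈ Set.Ioo a b, 0 < Y t)
    (hZpos : ∀ t ∈ Set.Ioo a b, 0 < Z t)
    (ρ p : ℝ → ℝ)
    (hρ : ∀ t, ρ t = (deriv φ t) ^ 2 / 2 + V (φ t))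
    (hp : ∀ t, p t = (deriv φ t) ^ 2 / 2 - V (φ t))
    (heqi : ∀ t ∈ Set.Ioo a b, (deriv X t / X t) * (deriv Y t / Y t) + (deriv X t / X t) * (deriv Z t / Z t) + (deriv Y t / Y t) * (deriv Z t / Z t) = K ^ 2 * ρ t)
    (heqii : ∀ t ∈ Set.Ioo a b, deriv (deriv X) t / X t + deriv (deriv Y) t / Y t + (deriv X t / X t) * (deriv Y t / Y t) = -(K ^ 2 * p t))
    (heqiii : ∀ t ∈ Set.Ioo a b, deriv (deriv X) t / X t + deriv (deriv Z) t / Z t + (deriv X t / X t) * (deriv Z t / Z t) = -(K ^ 2 * p t))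
    (heqiv : ∀ t ∈ Set.Ioo a b, deriv (deriv Y) t / Y t + deriv (deriv Z) t / Z t + (deriv Y t / Y t) * (deriv Z t / Z t) = -(K ^ 2 * p t))
    (θ : ℝ → ℝ)
    (hθ : ∀ t ∈ Set.Ioo a b, θ t = deriv X t / X t + deriv Y t / Y t + deriv Z t / Z t)
    (η₁ η₂ η₃ : ℝ → ℝ)
    (hη₁ : ∀ t ∈ Set.Ioo a b, η₁ t = deriv X t / X t - deriv Y t / Y t)
    (hη₂ : ∀ t ∈ Set.Ioo a b, η₂ t = deriv X t / X t - deriv Z t / Z t)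
    (hη₃ : ∀ t ∈ Set.Ioo a b, η₃ t = deriv Y t / Y t - deriv Z t / Z t)
    :
    (∀ t ∈ Set.Ioo a b,
        deriv η₁ t + θ t * η₁ t = 0 ∧
        deriv η₂ t + θ t * η₂ t = 0 ∧
        deriv η₃ t + θ t * η₃ t = 0) ∧
    (∃ k₁ k₂ k₃ : ℝ, ∀ t ∈ Set.Ioo a b,
        X t * Y t * Z t * η₁ t = k₁ ∧
        X t * Y t * Z t * η₂ t = k₂ ∧
        X t * Y t * Z t * η₃ t = k₃) := by
  have hX0 t ht := (hXpos t ht).ne'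
  have hY0 t ht := (hYpos t ht).ne'
  have hZ0 t ht := (hZpos t ht).ne'
  have h₁ : ∀ t ∈ Set.Ioo a b,
      HasDerivAt η₁ (-((deriv X t / X t + deriv Y t / Y t + deriv Z t / Z t) * η₁ t)) t :=
    fun t ht ↦ hasDerivAt_hubble_sub isOpen_Ioo ht (hX1 t ht) (hX2 t ht) (hY1 t ht) (hY2 t ht)
      (hX0 t ht) (hY0 t ht) hη₁ (by linear_combination heqiii t ht - heqiv t ht)
  have h₂ : ∀ t ∈ Set.Ioo a b,
      HasDerivAt η₂ (-((deriv X t / X t + deriv Y t / Y t + deriv Z t / Z t) * η₂ t)) t := by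
    intro t ht
    refine (hasDerivAt_hubble_sub (T := Y) isOpen_Ioo ht (hX1 t ht) (hX2 t ht) (hZ1 t ht)
      (hZ2 t ht) (hX0 t ht) (hZ0 t ht) hη₂
      (by linear_combination heqii t ht - heqiv t ht)).congr_deriv ?_
    ring
  have h₃ : ∀ t ∈ Set.Ioo a b,
      HasDerivAt η₃ (-((deriv X t / X t + deriv Y t / Y t + deriv Z t / Z t) * η₃ t)) t := by
    intro t ht
    refine (hasDerivAt_hubble_sub (T := X) isOpen_Ioo ht (hY1 t ht) (hY2 t ht) (hZ1 t ht)
      (hZ2 t ht) (hY0 t ht) (hZ0 t ht) hη₃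
      (by linear_combination heqii t ht - heqiii t ht)).congr_deriv ?_
    ring
  refine ⟨fun t ht ↦ ?_, ?_⟩
  · rw [(h₁ t ht).deriv, (h₂ t ht).deriv, (h₃ t ht).deriv, hθ t ht]
    exact ⟨neg_add_cancel _, neg_add_cancel _, neg_add_cancel _⟩
  · obtain ⟨k₁, hk₁⟩ := exists_volume_mul_eq_const hX1 hY1 hZ1 hX0 hY0 hZ0 h₁
    obtain ⟨k₂, hk₂⟩ := exists_volume_mul_eq_const hX1 hY1 hZ1 hX0 hY0 hZ0 h₂
    obtain ⟨k₃, hk₃⟩ := exists_volume_mul_eq_const hX1 hY1 hZ1 hX0 hY0 hZ0 h₃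
    exact ⟨k₁, k₂, k₃, fun t ht ↦ ⟨hk₁ t ht, hk₂ t ht, hk₃ t ht⟩⟩
end

section
/- Let (X, Y, Z, φ, V) be a solution of the Bianchi I field equations (i)-(iv) on an open interval I, with V differentiable (so that ρ and p are differentiable). Then the fluid conservation equation holds: ρ̇(t) + θ(t)(ρ(t) + p(t)) = 0 for all t ∈ I. -/
/-- The logarithmic derivative `f' / f` has derivative `f'' / f - (f' / f) ^ 2`. -/
theorem hasDerivAt_deriv_div {f : ℝ → ℝ} {t : ℝ} (hf : DifferentiableAt ℝ f t)
    (hf' : DifferentiableAt ℝ (deriv f) t) (h0 : f t ≠ 0) :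
    HasDerivAt (fun s => deriv f s / f s)
      (deriv (deriv f) t / f t - (deriv f t / f t) ^ 2) t := by
  refine (hf'.hasDerivAt.fun_div hf.hasDerivAt h0).congr_deriv ?_
  field_simp

/-- Fluid conservation: for a Bianchi I solution with differentiable potential `V`,
`ρ̇ + θ(ρ + p) = 0` on `I`. -/
theorem stmt_9
    (K a b : ℝ) (hK : 0 < K)
    (X Y Z φ : ℝ → ℝ) (V : ℝ → ℝ)
    (hX1 : ∀ t ∈ Set.Ioo a b, DifferentiableAt ℝ X t)
    (hX2 : ∀ t ∈ Set.Ioo a b, DifferentiableAt ℝ (deriv X) t)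
    (hY1 : ∀ t ∈ Set.Ioo a b, DifferentiableAt ℝ Y t)
    (hY2 : ∀ t ∈ Set.Ioo a b, DifferentiableAt ℝ (deriv Y) t)
    (hZ1 : ∀ t ∈ Set.Ioo a b, DifferentiableAt ℝ Z t)
    (hZ2 : ∀ t ∈ Set.Ioo a b, DifferentiableAt ℝ (deriv Z) t)
    (hφ1 : ∀ t ∈ Set.Ioo a b, DifferentiableAt ℝ φ t)
    (hφ2 : ∀ t ∈ Set.Ioo a b, DifferentiableAt ℝ (deriv φ) t)
    (hXpos : ∀ t ∈ Set.Ioo a b, 0 < X t)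
    (hYpos : ∀ t ∈ Set.Ioo a b, 0 < Y t)
    (hZpos : ∀ t ∈ Set.Ioo a b, 0 < Z t)
    (ρ p : ℝ → ℝ)
    (hρ : ∀ t, ρ t = (deriv φ t) ^ 2 / 2 + V (φ t))
    (hp : ∀ t, p t = (deriv φ t) ^ 2 / 2 - V (φ t))
    (heqi : ∀ t ∈ Set.Ioo a b, (deriv X t / X t) * (deriv Y t / Y t) + (deriv X t / X t) * (deriv Z t / Z t) + (deriv Y t / Y t) * (deriv Z t / Z t) = K ^ 2 * ρ t)
    (heqii : ∀ t ∈ Set.Ioo a b, deriv (deriv X) t / X t + deriv (deriv Y) t / Y t + (deriv X t / X t) * (deriv Y t / Y t) = -(K ^ 2 * p t))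
    (heqiii : ∀ t ∈ Set.Ioo a b, deriv (deriv X) t / X t + deriv (deriv Z) t / Z t + (deriv X t / X t) * (deriv Z t / Z t) = -(K ^ 2 * p t))
    (heqiv : ∀ t ∈ Set.Ioo a b, deriv (deriv Y) t / Y t + deriv (deriv Z) t / Z t + (deriv Y t / Y t) * (deriv Z t / Z t) = -(K ^ 2 * p t))
    (θ : ℝ → ℝ)
    (hθ : ∀ t ∈ Set.Ioo a b, θ t = deriv X t / X t + deriv Y t / Y t + deriv Z t / Z t)
    (hV : Differentiable ℝ V)
    :
    ∀ t ∈ Set.Ioo a b, deriv ρ t + θ t * (ρ t + p t) = 0 := by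
  intro t ht
  have hK2 : K ^ 2 ≠ 0 := pow_ne_zero 2 hK.ne'
  have hX : HasDerivAt (fun s => deriv X s / X s)
      (deriv (deriv X) t / X t - (deriv X t / X t) ^ 2) t :=
    hasDerivAt_deriv_div (hX1 t ht) (hX2 t ht) (hXpos t ht).ne'
  have hY : HasDerivAt (fun s => deriv Y s / Y s)
      (deriv (deriv Y) t / Y t - (deriv Y t / Y t) ^ 2) t :=
    hasDerivAt_deriv_div (hY1 t ht) (hY2 t ht) (hYpos t ht).ne'
  have hZ : HasDerivAt (fun s => deriv Z s / Z s)
      (deriv (deriv Z) t / Z t - (deriv Z t / Z t) ^ 2) t :=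
    hasDerivAt_deriv_div (hZ1 t ht) (hZ2 t ht) (hZpos t ht).ne'
  have hEq : (fun s => K ^ 2 * ρ s) =ᶠ[nhds t] fun s =>
      (deriv X s / X s) * (deriv Y s / Y s) + (deriv X s / X s) * (deriv Z s / Z s)
        + (deriv Y s / Y s) * (deriv Z s / Z s) :=
    Filter.eventually_of_mem (Ioo_mem_nhds ht.1 ht.2) fun s hs => (heqi s hs).symm
  have hD := ((((hX.fun_mul hY).fun_add (hX.fun_mul hZ)).fun_add
    (hY.fun_mul hZ)).congr_of_eventuallyEq hEq).deriv
  rw [deriv_const_mul_field] at hD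
  apply mul_left_cancel₀ hK2
  rw [hθ t ht]
  linear_combination hD + (deriv Z t / Z t) * heqii t ht + (deriv Y t / Y t) * heqiii t ht
    + (deriv X t / X t) * heqiv t ht
    - (deriv X t / X t + deriv Y t / Y t + deriv Z t / Z t) * heqi t ht
end

section
/- Under the forward-construction hypotheses with P ≡ 0, the expansion θ = Ẋ/X + Ẏ/Y + Ż/Z of the constructed functions X, Y, Z satisfies equation (3.16): θ̇(t) = E/(X(t)²Y(t)²Z(t)²) for all t ∈ I. -/
lemma logDeriv_rpow_mul_exp {w g : ℝ → ℝ} {w' g' t : ℝ} (p : ℝ) (hw : HasDerivAt w w' t)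
    (hg : HasDerivAt g g' t) (hpos : 0 < w t) :
    logDeriv (fun s => w s ^ p * Real.exp (g s)) t = p * (w' / w t) + g' := by
  have hwp : HasDerivAt (fun s => w s ^ p) (w' * p * w t ^ (p - 1)) t :=
    hw.rpow_const (Or.inl hpos.ne')
  have hne : w t ^ p ≠ 0 := (Real.rpow_pos_of_pos hpos p).ne'
  rw [logDeriv_apply, (hwp.fun_mul hg.exp).deriv, Real.rpow_sub_one hpos.ne']
  have := hpos.ne'
  field_simp

/-- Equation (3.16): in the case `P ≡ 0`, the expansion satisfies
`θ̇ = E/(X²Y²Z²)` on `I`. -/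
theorem stmt_12
    (K E a b : ℝ) (hK : 0 < K) (hE : E < 0)
    (u : ℝ → ℝ)
    (hu : Differentiable ℝ u) (hu' : Differentiable ℝ (deriv u))
    (hSch : ∀ x, deriv (deriv u) x + E * u x = 0)
    (σ : ℝ → ℝ)
    (hσ : ∀ t ∈ Set.Ioo a b, HasDerivAt σ (u (σ t)) t)
    (hupos : ∀ t ∈ Set.Ioo a b, 0 < u (σ t))
    (c₁ c₂ : ℝ) (hc : c₁ ^ 2 + c₁ * c₂ + c₂ ^ 2 = -(4 * E) / 3)
    (X Y Z : ℝ → ℝ)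
    (hXdef : ∀ t ∈ Set.Ioo a b, X t = (u (σ t)) ^ (-(1 : ℝ) / 3) * Real.exp (c₁ / 2 * σ t))
    (hYdef : ∀ t ∈ Set.Ioo a b, Y t = (u (σ t)) ^ (-(1 : ℝ) / 3) * Real.exp (c₂ / 2 * σ t))
    (hZdef : ∀ t ∈ Set.Ioo a b, Z t = (u (σ t)) ^ (-(1 : ℝ) / 3) * Real.exp (-(c₁ / 2 * σ t) - c₂ / 2 * σ t))
    (θ : ℝ → ℝ)
    (hθ : ∀ t ∈ Set.Ioo a b, θ t = deriv X t / X t + deriv Y t / Y t + deriv Z t / Z t)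
    :
    ∀ t ∈ Set.Ioo a b, deriv θ t = E / (X t ^ 2 * Y t ^ 2 * Z t ^ 2) := by
  have hσu : ∀ t ∈ Set.Ioo a b,
      HasDerivAt (fun s => u (σ s)) (deriv u (σ t) * u (σ t)) t := fun t ht =>
    (hu (σ t)).hasDerivAt.comp t (hσ t ht)
  have hlog : ∀ (F g : ℝ → ℝ) (g' t : ℝ), t ∈ Set.Ioo a b →
      (∀ s ∈ Set.Ioo a b, F s = u (σ s) ^ (-(1 : ℝ) / 3) * Real.exp (g s)) →
      HasDerivAt g g' t → deriv F t / F t = -(1 : ℝ) / 3 * deriv u (σ t) + g' := by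
    intro F g g' t ht hF hg
    have heq : F =ᶠ[nhds t] fun s => u (σ s) ^ (-(1 : ℝ) / 3) * Real.exp (g s) :=
      Filter.eventually_of_mem (isOpen_Ioo.mem_nhds ht) hF
    have h := logDeriv_rpow_mul_exp (-(1 : ℝ) / 3) (hσu t ht) hg (hupos t ht)
    rw [logDeriv_apply] at h
    rw [heq.deriv_eq, hF t ht, h, mul_div_cancel_right₀ _ (hupos t ht).ne']
  have hθu : ∀ t ∈ Set.Ioo a b, θ t = -deriv u (σ t) := by
    intro t ht
    have h₁ := (hσ t ht).const_mul (c₁ / 2)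
    have h₂ := (hσ t ht).const_mul (c₂ / 2)
    rw [hθ t ht, hlog X _ _ t ht hXdef h₁, hlog Y _ _ t ht hYdef h₂,
      hlog Z _ _ t ht hZdef (h₁.neg.sub h₂)]
    ring
  intro t ht
  have heq : θ =ᶠ[nhds t] fun s => -deriv u (σ s) :=
    Filter.eventually_of_mem (isOpen_Ioo.mem_nhds ht) hθu
  have hd : HasDerivAt (fun s => -deriv u (σ s)) (-(deriv (deriv u) (σ t) * u (σ t))) t :=
    ((hu' (σ t)).hasDerivAt.comp t (hσ t ht)).neg
  have hpos := hupos t ht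
  have hcube : (u (σ t) ^ (-(1 : ℝ) / 3)) ^ 3 = (u (σ t))⁻¹ := by
    rw [← Real.rpow_natCast, ← Real.rpow_mul hpos.le, ← Real.rpow_neg_one]
    norm_num
  have hexp : Real.exp (c₁ / 2 * σ t) * Real.exp (c₂ / 2 * σ t) *
      Real.exp (-(c₁ / 2 * σ t) - c₂ / 2 * σ t) = 1 := by
    rw [← Real.exp_add, ← Real.exp_add, Real.exp_eq_one_iff]
    ring
  have hXYZ : X t * Y t * Z t = (u (σ t))⁻¹ := by
    rw [hXdef t ht, hYdef t ht, hZdef t ht, ← hcube]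
    linear_combination (u (σ t) ^ (-(1 : ℝ) / 3)) ^ 3 * hexp
  rw [heq.deriv_eq, hd.deriv, ← mul_pow, ← mul_pow, hXYZ, inv_pow, div_inv_eq_mul]
  linear_combination -u (σ t) * hSch (σ t)
end

section
/- Under the forward-construction hypotheses with P ≡ 0, the function t ↦ θ(t)² + θ̇(t) is constant on I, where θ = Ẋ/X + Ẏ/Y + Ż/Z is the expansion of the constructed functions X, Y, Z. (Hence the potential V₀ := (θ² + θ̇)/(3K²) is a well-defined constant.) -/
/-- Logarithmic derivative of `u(σ)^p * exp (k σ)` along a solution of `σ̇ = u(σ)`. -/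
theorem logDeriv_rpow_mul_exp_comp_flow {u σ f : ℝ → ℝ} {a b p k t : ℝ}
    (hu : Differentiable ℝ u) (ht : t ∈ Set.Ioo a b)
    (hσ : HasDerivAt σ (u (σ t)) t) (hpos : 0 < u (σ t))
    (hf : ∀ s ∈ Set.Ioo a b, f s = u (σ s) ^ p * Real.exp (k * σ s)) :
    deriv f t / f t = p * deriv u (σ t) + k * u (σ t) := by
  have hfe : f =ᶠ[nhds t] fun s => u (σ s) ^ p * Real.exp (k * σ s) :=
    Filter.eventually_of_mem (isOpen_Ioo.mem_nhds ht) hf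
  have hd := (((hu (σ t)).hasDerivAt.comp t hσ).rpow_const (p := p) (Or.inl hpos.ne')).mul
    (hσ.const_mul k).exp
  have hd' : HasDerivAt f _ t := hd.congr_of_eventuallyEq hfe
  rw [hd'.deriv, hf t ht]
  simp only [Function.comp_apply]
  rw [Real.rpow_sub_one hpos.ne']
  have := Real.rpow_pos_of_pos hpos p
  field_simp

/-- The energy `u'² + E u²` of a solution of `u'' + E u = 0` is conserved. -/
theorem sq_deriv_add_const_mul_sq_eq {u : ℝ → ℝ} {E : ℝ}
    (hu : Differentiable ℝ u) (hu' : Differentiable ℝ (deriv u))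
    (hSch : ∀ x, deriv (deriv u) x + E * u x = 0) (x y : ℝ) :
    deriv u x ^ 2 + E * u x ^ 2 = deriv u y ^ 2 + E * u y ^ 2 := by
  have hd : ∀ x, HasDerivAt (fun x => deriv u x ^ 2 + E * u x ^ 2) 0 x := fun x => by
    refine (((hu' x).hasDerivAt.pow 2).add (((hu x).hasDerivAt.pow 2).const_mul E)).congr_deriv ?_
    linear_combination 2 * deriv u x * hSch x
  exact is_const_of_deriv_eq_zero (fun x => (hd x).differentiableAt) (fun x => (hd x).deriv) x y

/-- In the case `P ≡ 0`, the function `θ² + θ̇` is constant on `I`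
(so `V₀ := (θ² + θ̇)/(3K²)` is a well-defined constant). -/
theorem stmt_13
    (K E a b : ℝ) (hK : 0 < K) (hE : E < 0)
    (u : ℝ → ℝ)
    (hu : Differentiable ℝ u) (hu' : Differentiable ℝ (deriv u))
    (hSch : ∀ x, deriv (deriv u) x + E * u x = 0)
    (σ : ℝ → ℝ)
    (hσ : ∀ t ∈ Set.Ioo a b, HasDerivAt σ (u (σ t)) t)
    (hupos : ∀ t ∈ Set.Ioo a b, 0 < u (σ t))
    (c₁ c₂ : ℝ) (hc : c₁ ^ 2 + c₁ * c₂ + c₂ ^ 2 = -(4 * E) / 3)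
    (X Y Z : ℝ → ℝ)
    (hXdef : ∀ t ∈ Set.Ioo a b, X t = (u (σ t)) ^ (-(1 : ℝ) / 3) * Real.exp (c₁ / 2 * σ t))
    (hYdef : ∀ t ∈ Set.Ioo a b, Y t = (u (σ t)) ^ (-(1 : ℝ) / 3) * Real.exp (c₂ / 2 * σ t))
    (hZdef : ∀ t ∈ Set.Ioo a b, Z t = (u (σ t)) ^ (-(1 : ℝ) / 3) * Real.exp (-(c₁ / 2 * σ t) - c₂ / 2 * σ t))
    (θ : ℝ → ℝ)
    (hθ : ∀ t ∈ Set.Ioo a b, θ t = deriv X t / X t + deriv Y t / Y t + deriv Z t / Z t)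
    :
    ∃ c : ℝ, ∀ t ∈ Set.Ioo a b, θ t ^ 2 + deriv θ t = c := by
  have hθu : ∀ t ∈ Set.Ioo a b, θ t = -deriv u (σ t) := fun t ht => by
    rw [hθ t ht, logDeriv_rpow_mul_exp_comp_flow hu ht (hσ t ht) (hupos t ht) hXdef,
      logDeriv_rpow_mul_exp_comp_flow hu ht (hσ t ht) (hupos t ht) hYdef,
      logDeriv_rpow_mul_exp_comp_flow (k := -(c₁ / 2) - c₂ / 2) hu ht (hσ t ht) (hupos t ht)
        (fun s hs => by rw [hZdef s hs]; ring_nf)]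
    ring
  refine ⟨deriv u 0 ^ 2 + E * u 0 ^ 2, fun t ht => ?_⟩
  have hd : HasDerivAt θ (-(deriv (deriv u) (σ t) * u (σ t))) t :=
    ((hu' (σ t)).hasDerivAt.comp t (hσ t ht)).neg.congr_of_eventuallyEq
      (Filter.eventually_of_mem (isOpen_Ioo.mem_nhds ht) hθu)
  rw [hd.deriv, hθu t ht, ← sq_deriv_add_const_mul_sq_eq hu hu' hSch (σ t) 0]
  linear_combination -u (σ t) * hSch (σ t)
end

section
/- Let X, Y, Z : I → ℝ be twice-differentiable positive functions on an open interval I such that each of the three products X·Y·Z·η₁, X·Y·Z·η₂, X·Y·Z·η₃ is a constant function on I. Then the left-hand sides of equations (ii), (iii), (iv) coincide: Ẍ/X + Ÿ/Y + ẊẎ/(XY) = Ẍ/X + Z̈/Z + ẊŻ/(XZ) = Ÿ/Y + Z̈/Z + ẎŻ/(YZ) on I. -/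
/-- If `f g h (f'/f - g'/g)` is constant on an open set, then
`f''/f + (f'/f)(h'/h) = g''/g + (g'/g)(h'/h)` there. -/
theorem deriv_deriv_div_add_eq_of_mul_sub_logDeriv_eq_const {s : Set ℝ} (hs : IsOpen s)
    {f g h : ℝ → ℝ} {k t : ℝ} (ht : t ∈ s)
    (hf : DifferentiableAt ℝ f t) (hf' : DifferentiableAt ℝ (deriv f) t)
    (hg : DifferentiableAt ℝ g t) (hg' : DifferentiableAt ℝ (deriv g) t)
    (hh : DifferentiableAt ℝ h t)
    (hf0 : ∀ x ∈ s, f x ≠ 0) (hg0 : ∀ x ∈ s, g x ≠ 0) (hh0 : h t ≠ 0)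
    (hk : ∀ x ∈ s, f x * g x * h x * (deriv f x / f x - deriv g x / g x) = k) :
    deriv (deriv f) t / f t + deriv f t / f t * (deriv h t / h t) =
      deriv (deriv g) t / g t + deriv g t / g t * (deriv h t / h t) := by
  have hconst : (fun x => h x * (deriv f x * g x - deriv g x * f x)) =ᶠ[nhds t] fun _ => k := by
    filter_upwards [hs.mem_nhds ht] with x hx
    have hfx := hf0 x hx
    have hgx := hg0 x hx
    rw [← hk x hx]
    field_simp
  have hderiv := hh.hasDerivAt.mul
    ((hf'.hasDerivAt.mul hg.hasDerivAt).sub (hg'.hasDerivAt.mul hf.hasDerivAt))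
  have key := hderiv.unique ((hasDerivAt_const t k).congr_of_eventuallyEq hconst)
  simp only [Pi.mul_apply, Pi.sub_apply] at key
  have hft := hf0 t ht
  have hgt := hg0 t ht
  field_simp
  linear_combination key


/-- If each product `X·Y·Z·ηᵢ` is constant on `I`, then the left-hand sides of field
equations (ii), (iii), (iv) coincide on `I`. -/
theorem stmt_14 (a b : ℝ) (X Y Z : ℝ → ℝ)
    (hX1 : ∀ t ∈ Set.Ioo a b, DifferentiableAt ℝ X t)
    (hX2 : ∀ t ∈ Set.Ioo a b, DifferentiableAt ℝ (deriv X) t)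
    (hY1 : ∀ t ∈ Set.Ioo a b, DifferentiableAt ℝ Y t)
    (hY2 : ∀ t ∈ Set.Ioo a b, DifferentiableAt ℝ (deriv Y) t)
    (hZ1 : ∀ t ∈ Set.Ioo a b, DifferentiableAt ℝ Z t)
    (hZ2 : ∀ t ∈ Set.Ioo a b, DifferentiableAt ℝ (deriv Z) t)
    (hXpos : ∀ t ∈ Set.Ioo a b, 0 < X t)
    (hYpos : ∀ t ∈ Set.Ioo a b, 0 < Y t)
    (hZpos : ∀ t ∈ Set.Ioo a b, 0 < Z t)
    (η₁ η₂ η₃ : ℝ → ℝ)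
    (hη₁ : ∀ t ∈ Set.Ioo a b, η₁ t = deriv X t / X t - deriv Y t / Y t)
    (hη₂ : ∀ t ∈ Set.Ioo a b, η₂ t = deriv X t / X t - deriv Z t / Z t)
    (hη₃ : ∀ t ∈ Set.Ioo a b, η₃ t = deriv Y t / Y t - deriv Z t / Z t)
    (hk₁ : ∃ k : ℝ, ∀ t ∈ Set.Ioo a b, X t * Y t * Z t * η₁ t = k)
    (hk₂ : ∃ k : ℝ, ∀ t ∈ Set.Ioo a b, X t * Y t * Z t * η₂ t = k)
    (hk₃ : ∃ k : ℝ, ∀ t ∈ Set.Ioo a b, X t * Y t * Z t * η₃ t = k)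
    :
    ∀ t ∈ Set.Ioo a b,
      (deriv (deriv X) t / X t + deriv (deriv Y) t / Y t + (deriv X t / X t) * (deriv Y t / Y t) = deriv (deriv X) t / X t + deriv (deriv Z) t / Z t + (deriv X t / X t) * (deriv Z t / Z t)) ∧
      (deriv (deriv X) t / X t + deriv (deriv Z) t / Z t + (deriv X t / X t) * (deriv Z t / Z t) = deriv (deriv Y) t / Y t + deriv (deriv Z) t / Z t + (deriv Y t / Y t) * (deriv Z t / Z t)) := by
  obtain ⟨k₁, hk₁⟩ := hk₁
  obtain ⟨k₃, hk₃⟩ := hk₃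
  intro t ht
  have hXY := deriv_deriv_div_add_eq_of_mul_sub_logDeriv_eq_const isOpen_Ioo ht
    (hX1 t ht) (hX2 t ht) (hY1 t ht) (hY2 t ht) (hZ1 t ht)
    (fun x hx => (hXpos x hx).ne') (fun x hx => (hYpos x hx).ne') (hZpos t ht).ne'
    (k := k₁) fun x hx => by rw [← hη₁ x hx, hk₁ x hx]
  have hYZ := deriv_deriv_div_add_eq_of_mul_sub_logDeriv_eq_const isOpen_Ioo ht
    (hY1 t ht) (hY2 t ht) (hZ1 t ht) (hZ2 t ht) (hX1 t ht)
    (fun x hx => (hYpos x hx).ne') (fun x hx => (hZpos x hx).ne') (hXpos t ht).ne'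
    (k := k₃) fun x hx => by rw [← hη₃ x hx, ← hk₃ x hx]; ring
  constructor
  · linear_combination hYZ
  · linear_combination hXY
end

section
/- Let A, B > 0, E < 0, and c₀ ∈ ℝ, and define u(x) = A·e^(−√(−E)·x) − B·e^(√(−E)·x) and σ(t) = (1/(2√(−E)))·ln((A/B)·tanh²(√(−ABE)·(t − c₀))) for t > c₀, where √(−ABE) is the positive square root of −ABE > 0. Then σ̇(t) = u(σ(t)) for all t > c₀. -/
/-- The function `σ(t) = (1/(2√(−E))) ln((A/B) tanh²(√(−ABE)(t − c₀)))` solves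
`σ̇ = u∘σ` for `u(x) = A e^(−√(−E)x) − B e^(√(−E)x)` on `(c₀, ∞)`. -/
theorem stmt_16 (A B E c₀ : ℝ) (hA : 0 < A) (hB : 0 < B) (hE : E < 0)
    (u σ : ℝ → ℝ)
    (hu : ∀ x, u x = A * Real.exp (-Real.sqrt (-E) * x) - B * Real.exp (Real.sqrt (-E) * x))
    (hσ : ∀ t, σ t = 1 / (2 * Real.sqrt (-E)) *
      Real.log (A / B * (Real.tanh (Real.sqrt (-(A * B * E)) * (t - c₀))) ^ 2)) :
    ∀ t > c₀, HasDerivAt σ (u (σ t)) t := by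
  intro t ht
  have hw : √(-(A * B * E)) = √A * √B * √(-E) := by
    rw [← Real.sqrt_mul hA.le, ← Real.sqrt_mul (mul_pos hA hB).le, mul_neg]
  have hk : 0 < √(-E) := Real.sqrt_pos.2 (neg_pos.2 hE)
  have ha : 0 < √A := Real.sqrt_pos.2 hA
  have hb : 0 < √B := Real.sqrt_pos.2 hB
  have hA2 : A = √A ^ 2 := (Real.sq_sqrt hA.le).symm
  have hB2 : B = √B ^ 2 := (Real.sq_sqrt hB.le).symm
  rw [hw] at hσ
  generalize √(-E) = k at *
  generalize √A = a at *
  generalize √B = b at *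
  subst hA2 hB2
  have hσ' : σ = fun s => 1 / k * Real.log (a / b * (Real.sinh (a * b * k * (s - c₀)) /
      Real.cosh (a * b * k * (s - c₀)))) := by
    funext s
    rw [hσ, ← div_pow, ← mul_pow, Real.log_pow, Real.tanh_eq_sinh_div_cosh]
    push_cast
    field_simp
  have hS : 0 < Real.sinh (a * b * k * (t - c₀)) :=
    Real.sinh_pos_iff.2 (mul_pos (by positivity) (sub_pos.2 ht))
  have hC : 0 < Real.cosh (a * b * k * (t - c₀)) := Real.cosh_pos _
  have hlin : HasDerivAt (fun s => a * b * k * (s - c₀)) (a * b * k) t := by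
    simpa using ((hasDerivAt_id t).sub_const c₀).const_mul (a * b * k)
  have hd := ((((hlin.sinh.div hlin.cosh hC.ne').const_mul (a / b)).log
    (mul_pos (div_pos ha hb) (div_pos hS hC)).ne').const_mul (1 / k))
  have hkσ : k * σ t = Real.log (a / b * (Real.sinh (a * b * k * (t - c₀)) /
      Real.cosh (a * b * k * (t - c₀)))) := by
    rw [hσ']
    field_simp
  have hexp := Real.exp_log (mul_pos (div_pos ha hb) (div_pos hS hC))
  rw [hu, neg_mul, Real.exp_neg, hkσ, hexp, hσ']
  refine hd.congr_deriv ?_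
  simp only [Pi.div_apply]
  field_simp
end

section
/- Let A, B > 0, E < 0, c₀ ∈ ℝ, K > 0, and let c₁, c₂ be real constants with c₁² + c₁c₂ + c₂² = −4E/3. For t > c₀ set w(t) = √(−ABE)·(t − c₀), and define X(t) = (sinh(2w(t))/(2√(AB)))^(1/3) · (√(A/B)·tanh(w(t)))^(c₁/(2√(−E))), Y(t) = (sinh(2w(t))/(2√(AB)))^(1/3) · (√(A/B)·tanh(w(t)))^(c₂/(2√(−E))), Z(t) = (sinh(2w(t))/(2√(AB)))^(1/3) · (√(A/B)·tanh(w(t)))^(−(c₁+c₂)/(2√(−E))). Let φ be any constant function and let V be the constant potential V ≡ −4ABE/(3K²). Then (X, Y, Z, φ, V) solves the Bianchi I field equations (i)-(iv) on (c₀, ∞). -/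
/-- The scale factor `(sinh (2w) / k) ^ (1/3) * (m * tanh w) ^ a` with `w = ω * (t - c)` has
logarithmic derivative `(2ω/3) * (cosh (2w) + 3a) / sinh (2w)`. -/
lemma hasDerivAt_scaleFactor {ω c k m t : ℝ} (a : ℝ) (hω : 0 < ω) (hk : 0 < k) (hm : 0 < m)
    (ht : c < t) :
    HasDerivAt (fun t => (Real.sinh (2 * (ω * (t - c))) / k) ^ ((1 : ℝ) / 3) *
        (m * Real.tanh (ω * (t - c))) ^ a)
      ((Real.sinh (2 * (ω * (t - c))) / k) ^ ((1 : ℝ) / 3) * (m * Real.tanh (ω * (t - c))) ^ a *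
        (2 * ω / 3 * ((Real.cosh (2 * (ω * (t - c))) + 3 * a) /
          Real.sinh (2 * (ω * (t - c)))))) t := by
  have hw : 0 < ω * (t - c) := mul_pos hω (sub_pos.2 ht)
  have hsinh : 0 < Real.sinh (ω * (t - c)) := Real.sinh_pos_iff.2 hw
  have hcosh : 0 < Real.cosh (ω * (t - c)) := Real.cosh_pos _
  have hsinh2 : 0 < Real.sinh (2 * (ω * (t - c))) := Real.sinh_pos_iff.2 (by positivity)
  have htanh : 0 < Real.tanh (ω * (t - c)) := by
    rw [Real.tanh_eq_sinh_div_cosh]; positivity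
  have hd : HasDerivAt (fun t => ω * (t - c)) ω t := by
    simpa using ((hasDerivAt_id t).sub_const c).const_mul ω
  have hdsinh2 := ((hd.const_mul 2).sinh.div_const k).rpow_const (p := (1 : ℝ) / 3)
    (Or.inl (by positivity))
  have hdtanh : HasDerivAt (fun t => Real.tanh (ω * (t - c)))
      (ω / Real.cosh (ω * (t - c)) ^ 2) t := by
    simp only [Real.tanh_eq_sinh_div_cosh]
    refine (hd.sinh.div hd.cosh hcosh.ne').congr_deriv ?_
    congr 1
    linear_combination ω * Real.cosh_sq_sub_sinh_sq (ω * (t - c))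
  have hdtanh' := (hdtanh.const_mul m).rpow_const (p := a) (Or.inl (by positivity))
  refine (hdsinh2.mul hdtanh').congr_deriv ?_
  rw [Real.rpow_sub_one (by positivity), Real.rpow_sub_one (by positivity)]
  generalize (Real.sinh (2 * (ω * (t - c))) / k) ^ ((1 : ℝ) / 3) = P
  generalize (m * Real.tanh (ω * (t - c))) ^ a = Q
  rw [Real.tanh_eq_sinh_div_cosh]
  generalize hC : Real.cosh (2 * (ω * (t - c))) = C
  rw [Real.sinh_two_mul]
  field_simp

/-- First and second derivatives, relative to the function, of a function agreeing on `(c, ∞)` with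
`(sinh (2w) / k) ^ (1/3) * (m * tanh w) ^ a`, where `w = ω * (t - c)`. -/
lemma deriv_div_scaleFactor {ω c k m a t : ℝ} {F : ℝ → ℝ} (hω : 0 < ω) (hk : 0 < k) (hm : 0 < m)
    (hF : ∀ t ∈ Set.Ioi c, F t = (Real.sinh (2 * (ω * (t - c))) / k) ^ ((1 : ℝ) / 3) *
      (m * Real.tanh (ω * (t - c))) ^ a) (ht : c < t) :
    deriv F t / F t = 2 * ω / 3 * ((Real.cosh (2 * (ω * (t - c))) + 3 * a) /
      Real.sinh (2 * (ω * (t - c)))) ∧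
    deriv (deriv F) t / F t = 4 * ω ^ 2 / 9 * (((Real.cosh (2 * (ω * (t - c))) + 3 * a) ^ 2 - 3 -
      9 * a * Real.cosh (2 * (ω * (t - c)))) / Real.sinh (2 * (ω * (t - c))) ^ 2) := by
  have hderiv : ∀ t ∈ Set.Ioi c, HasDerivAt F (F t * (2 * ω / 3 *
      ((Real.cosh (2 * (ω * (t - c))) + 3 * a) / Real.sinh (2 * (ω * (t - c)))))) t := by
    intro t ht
    rw [hF t ht]
    exact (hasDerivAt_scaleFactor a hω hk hm ht).congr_of_eventuallyEq
      (Filter.eventuallyEq_of_mem (Ioi_mem_nhds ht) hF)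
  have hw : 0 < ω * (t - c) := mul_pos hω (sub_pos.2 ht)
  have hsinh2 : 0 < Real.sinh (2 * (ω * (t - c))) := Real.sinh_pos_iff.2 (by positivity)
  have htanh : 0 < Real.tanh (ω * (t - c)) := by
    rw [Real.tanh_eq_sinh_div_cosh]
    exact div_pos (Real.sinh_pos_iff.2 hw) (Real.cosh_pos _)
  have hFpos : 0 < F t := by rw [hF t ht]; positivity
  have hd : HasDerivAt (fun t => 2 * (ω * (t - c))) (2 * ω) t := by
    simpa using (((hasDerivAt_id t).sub_const c).const_mul ω).const_mul 2
  have hdd := ((hderiv t ht).mul (((hd.cosh.add_const (3 * a)).div hd.sinh hsinh2.ne').const_mul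
    (2 * ω / 3))).congr_of_eventuallyEq
      (Filter.eventuallyEq_of_mem (Ioi_mem_nhds ht) fun s hs => (hderiv s hs).deriv)
  constructor
  · rw [(hderiv t ht).deriv, mul_div_cancel_left₀ _ hFpos.ne']
  · rw [hdd.deriv]
    have hsq := Real.cosh_sq_sub_sinh_sq (2 * (ω * (t - c)))
    simp only [Pi.div_apply]
    generalize Real.cosh (2 * (ω * (t - c))) = C at *
    generalize Real.sinh (2 * (ω * (t - c))) = S at *
    field_simp
    linear_combination (-108) * hsq


/-- First example: the explicit anisotropic solution built from
`u(x) = A e^(−√(−E)x) − B e^(√(−E)x)` with `P ≡ 0`, constant scalar field and constant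
potential `V ≡ −4ABE/(3K²)`, solves the Bianchi I field equations on `(c₀, ∞)`. -/
theorem stmt_17 (A B E c₀ K c₁ c₂ φ₀ : ℝ)
    (hA : 0 < A) (hB : 0 < B) (hE : E < 0) (hK : 0 < K)
    (hc : c₁ ^ 2 + c₁ * c₂ + c₂ ^ 2 = -(4 * E) / 3)
    (X Y Z φ : ℝ → ℝ) (V : ℝ → ℝ)
    (hX : ∀ t ∈ Set.Ioi c₀, X t = (Real.sinh (2 * (Real.sqrt (-(A * B * E)) * (t - c₀))) / (2 * Real.sqrt (A * B))) ^ ((1 : ℝ) / 3) * (Real.sqrt (A / B) * Real.tanh (Real.sqrt (-(A * B * E)) * (t - c₀))) ^ (c₁ / (2 * Real.sqrt (-E))))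
    (hY : ∀ t ∈ Set.Ioi c₀, Y t = (Real.sinh (2 * (Real.sqrt (-(A * B * E)) * (t - c₀))) / (2 * Real.sqrt (A * B))) ^ ((1 : ℝ) / 3) * (Real.sqrt (A / B) * Real.tanh (Real.sqrt (-(A * B * E)) * (t - c₀))) ^ (c₂ / (2 * Real.sqrt (-E))))
    (hZ : ∀ t ∈ Set.Ioi c₀, Z t = (Real.sinh (2 * (Real.sqrt (-(A * B * E)) * (t - c₀))) / (2 * Real.sqrt (A * B))) ^ ((1 : ℝ) / 3) * (Real.sqrt (A / B) * Real.tanh (Real.sqrt (-(A * B * E)) * (t - c₀))) ^ (-(c₁ + c₂) / (2 * Real.sqrt (-E))))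
    (hφ : ∀ t, φ t = φ₀)
    (hV : ∀ x, V x = -(4 * A * B * E) / (3 * K ^ 2))
    (ρ p : ℝ → ℝ)
    (hρ : ∀ t, ρ t = (deriv φ t) ^ 2 / 2 + V (φ t))
    (hp : ∀ t, p t = (deriv φ t) ^ 2 / 2 - V (φ t))
    :
    ∀ t ∈ Set.Ioi c₀,
      ((deriv X t / X t) * (deriv Y t / Y t) + (deriv X t / X t) * (deriv Z t / Z t) + (deriv Y t / Y t) * (deriv Z t / Z t) = K ^ 2 * ρ t) ∧
      (deriv (deriv X) t / X t + deriv (deriv Y) t / Y t + (deriv X t / X t) * (deriv Y t / Y t) = -(K ^ 2 * p t)) ∧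
      (deriv (deriv X) t / X t + deriv (deriv Z) t / Z t + (deriv X t / X t) * (deriv Z t / Z t) = -(K ^ 2 * p t)) ∧
      (deriv (deriv Y) t / Y t + deriv (deriv Z) t / Z t + (deriv Y t / Y t) * (deriv Z t / Z t) = -(K ^ 2 * p t)) := by
  intro t ht
  have hE' : 0 < -E := neg_pos.2 hE
  have hABE : 0 < -(A * B * E) := by nlinarith [mul_pos (mul_pos hA hB) hE']
  have hω : 0 < Real.sqrt (-(A * B * E)) := Real.sqrt_pos.2 hABE
  have hω2 : Real.sqrt (-(A * B * E)) ^ 2 = -(A * B * E) := Real.sq_sqrt hABE.le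
  have hk : 0 < 2 * Real.sqrt (A * B) := by positivity
  have hm : 0 < Real.sqrt (A / B) := by positivity
  have hs : 0 < Real.sqrt (-E) := Real.sqrt_pos.2 hE'
  have hs2 : Real.sqrt (-E) ^ 2 = -E := Real.sq_sqrt hE'.le
  obtain ⟨hX1, hX2⟩ := deriv_div_scaleFactor hω hk hm hX ht
  obtain ⟨hY1, hY2⟩ := deriv_div_scaleFactor hω hk hm hY ht
  obtain ⟨hZ1, hZ2⟩ := deriv_div_scaleFactor hω hk hm hZ ht
  have hφ' : deriv φ t = 0 := by
    rw [funext hφ]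
    exact deriv_const t φ₀
  have hρt : K ^ 2 * ρ t = 4 / 3 * Real.sqrt (-(A * B * E)) ^ 2 := by
    rw [hρ, hφ', hV, hω2]; field_simp; ring
  have hpt : -(K ^ 2 * p t) = 4 / 3 * Real.sqrt (-(A * B * E)) ^ 2 := by
    rw [hp, hφ', hV, hω2]; field_simp; ring
  have hw : 0 < Real.sqrt (-(A * B * E)) * (t - c₀) := mul_pos hω (sub_pos.2 ht)
  have hS : 0 < Real.sinh (2 * (Real.sqrt (-(A * B * E)) * (t - c₀))) :=
    Real.sinh_pos_iff.2 (by positivity)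
  have hsq := Real.cosh_sq_sub_sinh_sq (2 * (Real.sqrt (-(A * B * E)) * (t - c₀)))
  have hab : (c₁ / (2 * Real.sqrt (-E))) ^ 2 +
      c₁ / (2 * Real.sqrt (-E)) * (c₂ / (2 * Real.sqrt (-E))) +
      (c₂ / (2 * Real.sqrt (-E))) ^ 2 = 1 / 3 := by
    field_simp
    rw [hs2]
    linear_combination 3 * hc
  have hsum : -(c₁ + c₂) / (2 * Real.sqrt (-E)) =
      -(c₁ / (2 * Real.sqrt (-E))) - c₂ / (2 * Real.sqrt (-E)) := by ring
  rw [hX1, hX2, hY1, hY2, hZ1, hZ2, hρt, hpt, hsum]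
  generalize c₁ / (2 * Real.sqrt (-E)) = a at *
  generalize c₂ / (2 * Real.sqrt (-E)) = b at *
  generalize Real.cosh (2 * (Real.sqrt (-(A * B * E)) * (t - c₀))) = C at *
  generalize Real.sinh (2 * (Real.sqrt (-(A * B * E)) * (t - c₀))) = S at *
  refine ⟨?_, ?_, ?_, ?_⟩
  · field_simp
    linear_combination 12 * hsq - 36 * hab
  all_goals
    field_simp
    linear_combination 108 * hsq + 324 * hab
end

section
/- Let A > 0, E < 0, c₀ ∈ ℝ, K > 0, and let c₁, c₂ be real constants with c₁² + c₁c₂ + c₂² = −4E/3. For t > c₀ define X(t) = A^(c₁/(2√(−E))) · (√(−E)·(t − c₀))^(c₁/(2√(−E)) + 1/3), Y(t) = A^(c₂/(2√(−E))) · (√(−E)·(t − c₀))^(c₂/(2√(−E)) + 1/3), Z(t) = A^(−(c₁+c₂)/(2√(−E))) · (√(−E)·(t − c₀))^(−(c₁+c₂)/(2√(−E)) + 1/3). Let φ be any constant function and V ≡ 0. Then (X, Y, Z, φ, V) solves the Bianchi I field equations (i)-(iv) on (c₀, ∞) (it is a vacuum solution, with ρ = p = 0). -/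
open Filter in
/-- The logarithmic derivative and the normalized second derivative of a power law
`t ↦ C (s (t - c₀)) ^ a` on `(c₀, ∞)`. -/
theorem power_law_deriv_ratios {C s c₀ a : ℝ} (hC : C ≠ 0) (hs : 0 < s) {f : ℝ → ℝ}
    (hf : ∀ t ∈ Set.Ioi c₀, f t = C * (s * (t - c₀)) ^ a) {t : ℝ} (ht : t ∈ Set.Ioi c₀) :
    deriv f t / f t = a / (t - c₀) ∧
      deriv (deriv f) t / f t = a * (a - 1) / (t - c₀) ^ 2 := by
  have hpos : ∀ r ∈ Set.Ioi c₀, 0 < r - c₀ := fun r hr => sub_pos.2 hr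
  have hne : ∀ r ∈ Set.Ioi c₀, f r ≠ 0 := fun r hr => by
    rw [hf r hr]
    exact mul_ne_zero hC (Real.rpow_pos_of_pos (mul_pos hs (hpos r hr)) a).ne'
  have hder : ∀ r ∈ Set.Ioi c₀, HasDerivAt f (f r * (a / (r - c₀))) r := fun r hr => by
    have hr0 := hpos r hr
    have hlin : HasDerivAt (fun x => s * (x - c₀)) s r := by
      simpa using ((hasDerivAt_id r).sub_const c₀).const_mul s
    have hpow := (hlin.rpow_const (p := a) (Or.inl (mul_pos hs hr0).ne')).const_mul C
    have heq : f =ᶠ[nhds r] fun x => C * (s * (x - c₀)) ^ a :=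
      eventually_of_mem (Ioi_mem_nhds hr) hf
    refine (hpow.congr_of_eventuallyEq heq).congr_deriv ?_
    rw [hf r hr, Real.rpow_sub_one (mul_pos hs hr0).ne']
    field_simp
  have ht0 := hpos t ht
  have hft := hne t ht
  have hderiv : deriv f =ᶠ[nhds t] fun r => f r * (a / (r - c₀)) :=
    eventually_of_mem (Ioi_mem_nhds ht) fun r hr => (hder r hr).deriv
  have hquot : HasDerivAt (fun r => a / (r - c₀)) (-a / (t - c₀) ^ 2) t := by
    simpa using (hasDerivAt_const t a).fun_div ((hasDerivAt_id t).sub_const c₀) ht0.ne'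
  constructor
  · rw [(hder t ht).deriv]
    field_simp
  · rw [hderiv.deriv_eq, ((hder t ht).fun_mul hquot).deriv]
    field_simp
    ring


/-- Second example: the power-law vacuum solution built from `u(x) = A e^(−√(−E)x)` with
`P ≡ 0`, constant scalar field and `V ≡ 0`, solves the Bianchi I field equations on
`(c₀, ∞)`, with `ρ = p = 0`. -/
theorem stmt_18 (A E c₀ K c₁ c₂ φ₀ : ℝ)
    (hA : 0 < A) (hE : E < 0) (hK : 0 < K)
    (hc : c₁ ^ 2 + c₁ * c₂ + c₂ ^ 2 = -(4 * E) / 3)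
    (X Y Z φ : ℝ → ℝ) (V : ℝ → ℝ)
    (hX : ∀ t ∈ Set.Ioi c₀, X t = A ^ (c₁ / (2 * Real.sqrt (-E))) * (Real.sqrt (-E) * (t - c₀)) ^ (c₁ / (2 * Real.sqrt (-E)) + 1 / 3))
    (hY : ∀ t ∈ Set.Ioi c₀, Y t = A ^ (c₂ / (2 * Real.sqrt (-E))) * (Real.sqrt (-E) * (t - c₀)) ^ (c₂ / (2 * Real.sqrt (-E)) + 1 / 3))
    (hZ : ∀ t ∈ Set.Ioi c₀, Z t = A ^ (-(c₁ + c₂) / (2 * Real.sqrt (-E))) * (Real.sqrt (-E) * (t - c₀)) ^ (-(c₁ + c₂) / (2 * Real.sqrt (-E)) + 1 / 3))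
    (hφ : ∀ t, φ t = φ₀)
    (hV : ∀ x, V x = 0)
    (ρ p : ℝ → ℝ)
    (hρ : ∀ t, ρ t = (deriv φ t) ^ 2 / 2 + V (φ t))
    (hp : ∀ t, p t = (deriv φ t) ^ 2 / 2 - V (φ t))
    :
    ∀ t ∈ Set.Ioi c₀,
      ((deriv X t / X t) * (deriv Y t / Y t) + (deriv X t / X t) * (deriv Z t / Z t) + (deriv Y t / Y t) * (deriv Z t / Z t) = K ^ 2 * ρ t) ∧
      (deriv (deriv X) t / X t + deriv (deriv Y) t / Y t + (deriv X t / X t) * (deriv Y t / Y t) = -(K ^ 2 * p t)) ∧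
      (deriv (deriv X) t / X t + deriv (deriv Z) t / Z t + (deriv X t / X t) * (deriv Z t / Z t) = -(K ^ 2 * p t)) ∧
      (deriv (deriv Y) t / Y t + deriv (deriv Z) t / Z t + (deriv Y t / Y t) * (deriv Z t / Z t) = -(K ^ 2 * p t)) ∧
      ρ t = 0 ∧ p t = 0 := by
  intro t ht
  have hs : 0 < Real.sqrt (-E) := Real.sqrt_pos.2 (neg_pos.2 hE)
  have hs2 : Real.sqrt (-E) ^ 2 = -E := Real.sq_sqrt (neg_pos.2 hE).le
  have hφ' : deriv φ t = 0 := by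
    rw [funext hφ]
    exact deriv_const t φ₀
  have hρ0 : ρ t = 0 := by rw [hρ, hφ', hV]; norm_num
  have hp0 : p t = 0 := by rw [hp, hφ', hV]; norm_num
  obtain ⟨hX1, hX2⟩ := power_law_deriv_ratios (Real.rpow_pos_of_pos hA _).ne' hs hX ht
  obtain ⟨hY1, hY2⟩ := power_law_deriv_ratios (Real.rpow_pos_of_pos hA _).ne' hs hY ht
  obtain ⟨hZ1, hZ2⟩ := power_law_deriv_ratios (Real.rpow_pos_of_pos hA _).ne' hs hZ ht
  have ht0 : t - c₀ ≠ 0 := (sub_pos.2 ht).ne'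
  rw [hX1, hX2, hY1, hY2, hZ1, hZ2, hρ0, hp0]
  generalize Real.sqrt (-E) = s at hs hs2
  have hquad : c₁ ^ 2 + c₁ * c₂ + c₂ ^ 2 = 4 * s ^ 2 / 3 := by rw [hc, hs2]; ring
  refine ⟨?_, ?_, ?_, ?_, rfl, rfl⟩ <;> field_simp <;> linarith
end
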